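/- arXiv:2003.00841 — 2 statements merged into one kernel-verified Lean document; each statement's English description precedes it below -/
import Mathlib

section
/- Let p ∈ ℂ^n, let φ₁,…,φ_N be holomorphic functions on a neighborhood of p with φ_i(p) = 0 for all i, let 0 ≤ s ≤ N, and set D(z) = Σ_{i=1}^s |φ_i(z)|² − Σ_{i=s+1}^N |φ_i(z)|². Assume D is in Bochner form at p. Suppose there exist λ ∈ ℝ and holomorphic functions f₁,…,f_n, h on a neighborhood of p such that det[∂²D/∂z_a ∂z̄_b]_{a,b=1,…,n} = exp(−(λ/2)D − f_X + h + conj(h)) on a neighborhood of p, where f_X := Σ_{j=1}^n (f_j · ∂D/∂z_j + conj(f_j) · ∂D/∂z̄_j). Then the function −(λ/2)D − f_X + h + conj(h) is constant on a neighborhood of p; in particular det[∂²D/∂z_a ∂z̄_b] is constant on a neighborhood of p. -/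
open Filter Topology Complex

/-- Wirtinger derivative `∂F/∂z_j = ½(∂F/∂x_j − i ∂F/∂y_j)`. -/
noncomputable def wderiv {n : ℕ} (j : Fin n) (F : (Fin n → ℂ) → ℂ) (z : Fin n → ℂ) : ℂ :=
  (1 / 2 : ℂ) * (fderiv ℝ F z (Pi.single j 1) - Complex.I * fderiv ℝ F z (Pi.single j Complex.I))

/-- Conjugate Wirtinger derivative `∂F/∂z̄_j = ½(∂F/∂x_j + i ∂F/∂y_j)`. -/
noncomputable def wderivBar {n : ℕ} (j : Fin n) (F : (Fin n → ℂ) → ℂ) (z : Fin n → ℂ) : ℂ :=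
  (1 / 2 : ℂ) * (fderiv ℝ F z (Pi.single j 1) + Complex.I * fderiv ℝ F z (Pi.single j Complex.I))

/-- Bochner form at `p` (expansion `|z−p|² + Σ_{|j|≥2,|k|≥2} b_{jk}(z−p)^j (z̄−p̄)^k`),
encoded through the holomorphic extension `E(z,w)` with `D(z) = E(z, z̄)`. -/
def IsBochnerAt {n : ℕ} (D : (Fin n → ℂ) → ℂ) (p : Fin n → ℂ) : Prop :=
  ∃ (E : (Fin n → ℂ) → (Fin n → ℂ) → ℂ) (U V : Set (Fin n → ℂ)),
    IsOpen U ∧ IsOpen V ∧ p ∈ U ∧ star p ∈ V ∧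
    DifferentiableOn ℂ (fun zw : (Fin n → ℂ) × (Fin n → ℂ) => E zw.1 zw.2) (U ×ˢ V) ∧
    (∀ᶠ z in 𝓝 p, D z = E z (star z)) ∧
    (let R : (Fin n → ℂ) → (Fin n → ℂ) → ℂ := fun z w =>
       E z w - ∑ j : Fin n, (z j - p j) * (w j - (starRingEnd ℂ) (p j))
     (∀ w ∈ V, R p w = 0 ∧ fderiv ℂ (fun z => R z w) p = 0) ∧
     (∀ z ∈ U, R z (star p) = 0 ∧ fderiv ℂ (fun w => R z w) (star p) = 0))

open Metric (ball closedBall)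

/-- A finitely generated commutative `ℂ`-algebra whose generators are uniformly bounded on all
characters is integral over `ℂ`. -/
theorem isIntegral_of_forall_character_norm_le {A : Type*} [CommRing A] [Algebra ℂ A]
    [Nontrivial A] {S : Set A} (hS : S.Finite) (hgen : Algebra.adjoin ℂ S = ⊤) (C : ℝ)
    (hC : ∀ χ : A →ₐ[ℂ] ℂ, ∀ x ∈ S, ‖χ x‖ ≤ C) : Algebra.IsIntegral ℂ A := by
  have hft : Algebra.FiniteType ℂ A := ⟨⟨hS.toFinset, by simpa using hgen⟩⟩
  obtain ⟨s, g, hg, hint⟩ := exists_integral_inj_algHom_of_fg ℂ A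
  have hbdd : ∀ y : A, ∃ B : ℝ, ∀ χ : A →ₐ[ℂ] ℂ, ‖χ y‖ ≤ B := by
    intro y
    have hy : y ∈ Algebra.adjoin ℂ S := hgen ▸ Algebra.mem_top
    induction hy using Algebra.adjoin_induction with
    | mem x hx => exact ⟨C, fun χ => hC χ x hx⟩
    | algebraMap r => exact ⟨‖r‖, fun χ => by simp⟩
    | add x y _ _ hx hy =>
      obtain ⟨B₁, h₁⟩ := hx
      obtain ⟨B₂, h₂⟩ := hy
      exact ⟨B₁ + B₂, fun χ => by
        rw [map_add]; exact (norm_add_le _ _).trans (add_le_add (h₁ χ) (h₂ χ))⟩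
    | mul x y _ _ hx hy =>
      obtain ⟨B₁, h₁⟩ := hx
      obtain ⟨B₂, h₂⟩ := hy
      exact ⟨B₁ * B₂, fun χ => by
        rw [map_mul, norm_mul]
        exact mul_le_mul (h₁ χ) (h₂ χ) (norm_nonneg _) ((norm_nonneg _).trans (h₁ χ))⟩
  have hchar : ∀ c : Fin s → ℂ, ∃ χ : A →ₐ[ℂ] ℂ, ∀ i, χ (g (MvPolynomial.X i)) = c i := by
    intro c
    let e : MvPolynomial (Fin s) ℂ →ₐ[ℂ] ℂ := MvPolynomial.aeval c
    have hmax : (RingHom.ker e.toRingHom).IsMaximal :=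
      RingHom.ker_isMaximal_of_surjective _ fun z => ⟨MvPolynomial.C z, by simp [e]⟩
    let := g.toRingHom.toAlgebra
    have : Algebra.IsIntegral (MvPolynomial (Fin s) ℂ) A := ⟨hint⟩
    obtain ⟨Q, hQ, hQP⟩ := Ideal.exists_ideal_over_maximal_of_isIntegral (S := A)
      (RingHom.ker e.toRingHom) (((RingHom.injective_iff_ker_eq_bot
        (algebraMap (MvPolynomial (Fin s) ℂ) A)).mp hg).trans_le bot_le)
    let := Ideal.Quotient.field Q
    have : Module.Finite ℂ (A ⧸ Q) := finite_of_finite_type_of_isJacobsonRing ℂ (A ⧸ Q)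
    let E : ℂ ≃ₐ[ℂ] (A ⧸ Q) := AlgEquiv.ofBijective (Algebra.ofId ℂ (A ⧸ Q))
      IsAlgClosed.algebraMap_bijective_of_isIntegral
    refine ⟨(E.symm : (A ⧸ Q) →ₐ[ℂ] ℂ).comp (Ideal.Quotient.mkₐ ℂ Q), fun i => ?_⟩
    have hmem : MvPolynomial.X i - MvPolynomial.C (c i) ∈
        Q.comap (algebraMap (MvPolynomial (Fin s) ℂ) A) := by
      rw [hQP]
      simp [RingHom.mem_ker, e]
    have hmem' : g (MvPolynomial.X i) - algebraMap ℂ A (c i) ∈ Q := by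
      have h1 : g (MvPolynomial.X i - MvPolynomial.C (c i)) ∈ Q := hmem
      rw [map_sub] at h1
      have h2 : g (MvPolynomial.C (c i)) = algebraMap ℂ A (c i) := by
        rw [← MvPolynomial.algebraMap_eq, AlgHom.commutes]
      rwa [h2] at h1
    have : Ideal.Quotient.mk Q (g (MvPolynomial.X i)) = E (c i) := by
      have h3 := Ideal.Quotient.eq.mpr hmem'
      rw [h3]; rfl
    simp [this]
  rcases Nat.eq_zero_or_pos s with rfl | hs
  · refine ⟨fun x => ?_⟩
    have h1 : (algebraMap ℂ A) = g.toRingHom.comp (MvPolynomial.C) := by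
      ext z
      simp [← MvPolynomial.algebraMap_eq]
    have h2 : (algebraMap ℂ A).IsIntegral := by
      rw [h1]
      exact RingHom.IsIntegral.trans _ _
        (RingHom.isIntegral_of_surjective _ (MvPolynomial.C_surjective (Fin 0))) hint
    exact h2 x
  · exfalso
    obtain ⟨B, hB⟩ := hbdd (g (MvPolynomial.X ⟨0, hs⟩))
    obtain ⟨χ, hχ⟩ := hchar fun _ => ((|B| + 1 : ℝ) : ℂ)
    have := hB χ
    rw [hχ, Complex.norm_real, Real.norm_eq_abs, abs_of_nonneg (by positivity)] at this
    linarith [le_abs_self B]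

/-- A finite family of holomorphic functions on a disc is reconstructed, with holomorphic
coefficients, from finitely many of its derivatives at the centre. -/
theorem exists_eq_sum_mul_iteratedDeriv {ι : Type*} [Fintype ι] {R : ℝ}
    (d : ι → ℂ → ℂ) (hd : ∀ j, DifferentiableOn ℂ (d j) (ball 0 R)) :
    ∃ (m : ℕ) (κ : Fin m → ℕ) (δ : Fin m → ℂ → ℂ),
      (∀ i, DifferentiableOn ℂ (δ i) (ball 0 R)) ∧
      ∀ j, ∀ s ∈ ball (0 : ℂ) R, d j s = ∑ i, δ i s * iteratedDeriv (κ i) (d j) 0 := by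
  classical
  let v : ℕ → ι → ℂ := fun k j => iteratedDeriv k (d j) 0
  obtain ⟨f, hf, hspan, hli⟩ := Submodule.exists_fun_fin_finrank_span_eq ℂ (Set.range v)
  choose κ hκ using hf
  have hmem : ∀ s ∈ ball (0 : ℂ) R, (fun j => d j s) ∈ Submodule.span ℂ (Set.range v) := by
    intro s hs
    by_contra hns
    obtain ⟨ℓ, hℓ, hker⟩ := Submodule.exists_le_ker_of_notMem hns
    apply hℓ
    have h1 : HasSum (fun n : ℕ => ℓ (fun j =>
        ((n.factorial : ℂ))⁻¹ • (s - 0) ^ n • iteratedDeriv n (d j) 0)) (ℓ fun j => d j s) := by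
      have h2 : HasSum (fun (n : ℕ) (j : ι) =>
          ((n.factorial : ℂ))⁻¹ • (s - 0) ^ n • iteratedDeriv n (d j) 0) (fun j => d j s) :=
        Pi.hasSum.mpr fun j => Complex.hasSum_taylorSeries_on_ball (hd j) hs
      exact h2.map ℓ.toAddMonoidHom (LinearMap.continuous_of_finiteDimensional ℓ)
    have h3 : ∀ n : ℕ, ℓ (fun j =>
        ((n.factorial : ℂ))⁻¹ • (s - 0) ^ n • iteratedDeriv n (d j) 0) = 0 := by
      intro n
      have h4 : ℓ (v n) = 0 := hker (Submodule.subset_span ⟨n, rfl⟩)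
      have h5 : (fun j => ((n.factorial : ℂ))⁻¹ • (s - 0) ^ n • iteratedDeriv n (d j) 0)
          = ((n.factorial : ℂ))⁻¹ • (s - 0) ^ n • v n := by
        ext j; simp [v]
      rw [h5, map_smul, map_smul, h4]; simp
    simp only [h3] at h1
    exact h1.unique hasSum_zero
  obtain ⟨L, hL⟩ := LinearMap.exists_leftInverse_of_injective (Fintype.linearCombination ℂ f)
    (LinearMap.ker_eq_bot.mpr (linearIndependent_iff_injective_fintypeLinearCombination.mp hli))
  refine ⟨_, κ, fun i s => L (fun j => d j s) i, fun i => ?_, fun j s hs => ?_⟩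
  · have : (fun s => L (fun j => d j s) i) =
        fun s => ∑ j, d j s * L (fun k => if j = k then 1 else 0) i := by
      ext s
      rw [LinearMap.pi_apply_eq_sum_univ L]
      simp
    change DifferentiableOn ℂ (fun s => L (fun j => d j s) i) _
    rw [this]
    fun_prop
  · change d j s = ∑ i, L (fun j => d j s) i * iteratedDeriv (κ i) (d j) 0
    have h1 := hmem s hs
    rw [← hspan, ← Fintype.range_linearCombination] at h1
    obtain ⟨y, hy⟩ := h1
    have h2 : L (fun j => d j s) = y := by
      rw [← hy]; exact LinearMap.congr_fun hL y
    rw [h2]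
    have h3 := congrFun hy j
    rw [← h3]
    simp [Fintype.linearCombination_apply, ← hκ, v]

theorem iteratedDeriv_sum_mul_const {ι : Type*} [Fintype ι] {R : ℝ} (hR : 0 < R)
    {d : ι → ℂ → ℂ} (hd : ∀ j, DifferentiableOn ℂ (d j) (ball 0 R)) (X : ι → ℂ) (n : ℕ) :
    iteratedDeriv n (fun s => ∑ i, d i s * X i) 0 = ∑ i, iteratedDeriv n (d i) 0 * X i := by
  have hc : ∀ i, ContDiffAt ℂ n (d i) 0 := fun i =>
    ((hd i).analyticAt (Metric.ball_mem_nhds 0 hR)).contDiffAt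
  rw [iteratedDeriv_fun_sum fun i _ => (hc i).mul contDiffAt_const]
  refine Finset.sum_congr rfl fun i _ => ?_
  simp_rw [mul_comm _ (X i)]
  exact iteratedDeriv_const_mul _ (hc i)

/-- An inequality of the form `S ≤ K * (A + N * log (1 + S))` bounds `S`. -/
theorem le_sq_of_le_mul_add_log {S K A N : ℝ} (hS : 0 ≤ S) (hK : 0 ≤ K) (hA : 0 ≤ A) (hN : 0 ≤ N)
    (h : S ≤ K * (A + N * Real.log (1 + S))) : S ≤ (K * A + 2 * K * N + 1) ^ 2 := by
  set u := √(1 + S) with hu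
  have hu2 : u ^ 2 = 1 + S := Real.sq_sqrt (by linarith)
  have hu0 : 0 ≤ u := Real.sqrt_nonneg _
  have hu1 : 1 ≤ u := by nlinarith
  have hlog : Real.log (1 + S) ≤ 2 * u := by
    rw [← hu2, Real.log_pow]
    have := Real.log_le_self hu0
    push_cast
    linarith
  have h1 : S ≤ K * A + 2 * K * N * u := by
    have h2 : K * (N * Real.log (1 + S)) ≤ K * (N * (2 * u)) := by gcongr
    nlinarith
  have hKA : 0 ≤ K * A := by positivity
  have hKN : 0 ≤ K * N := by positivity
  have h3 : u ≤ K * A + 2 * K * N + 1 := by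
    by_contra! hlt
    nlinarith
  nlinarith

/-- If `g = exp f` on a disc with `f 0 = 0`, where `f` and `g` depend linearly on parameters
`X` and `Y` that are derivatives of `f` and `g` at the centre, then `X` and `Y` are bounded. -/
theorem exists_forall_norm_le_of_eq_exp {m m' : ℕ} {R : ℝ} (hR : 0 < R)
    (κ : Fin m → ℕ) (β : Fin m → ℂ → ℂ) (hβ : ∀ i, DifferentiableOn ℂ (β i) (ball 0 R))
    (κ' : Fin m' → ℕ) (δ : Fin m' → ℂ → ℂ) (hδ : ∀ i, DifferentiableOn ℂ (δ i) (ball 0 R)) :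
    ∃ C : ℝ, ∀ (X : Fin m → ℂ) (Y : Fin m' → ℂ),
      (∀ l, X l = ∑ i, iteratedDeriv (κ l) (β i) 0 * X i) →
      (∀ l, Y l = ∑ i, iteratedDeriv (κ' l) (δ i) 0 * Y i) →
      ∑ i, β i 0 * X i = 0 →
      (∀ s ∈ ball (0 : ℂ) R, ∑ i, δ i s * Y i = exp (∑ i, β i s * X i)) →
      (∀ i, ‖X i‖ ≤ C) ∧ ∀ i, ‖Y i‖ ≤ C := by
  obtain ⟨L, r, hL, hr, hrR, hLβ, hLδ⟩ : ∃ L r : ℝ, 0 ≤ L ∧ 0 < r ∧ r < R ∧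
      (∀ i, ∀ s : ℂ, ‖s‖ ≤ r → ‖β i s - β i 0‖ ≤ L * ‖s‖) ∧
      (∀ i, ∀ s : ℂ, ‖s‖ ≤ r → ‖δ i s‖ ≤ L) := by
    have h1 : ∀ i, ∃ c : ℝ, ∀ᶠ s in 𝓝 (0 : ℂ), ‖β i s - β i 0‖ ≤ c * ‖s‖ := by
      intro i
      have := ((hβ i).differentiableAt (Metric.ball_mem_nhds 0 hR)).isBigO_sub
      simpa using this.bound
    have h2 : ∀ i, ∀ᶠ s in 𝓝 (0 : ℂ), ‖δ i s‖ ≤ ‖δ i 0‖ + 1 := by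
      intro i
      have := ((hδ i).differentiableAt (Metric.ball_mem_nhds 0 hR)).continuousAt.norm
      exact (this.eventually (gt_mem_nhds (lt_add_one _))).mono fun _ h => h.le
    choose c hc using h1
    obtain ⟨ε, hε, hball⟩ := Metric.eventually_nhds_iff.mp
      ((eventually_all.mpr hc).and (eventually_all.mpr h2))
    refine ⟨∑ i, |c i| + ∑ i, (‖δ i 0‖ + 1), min (ε / 2) (R / 2), by positivity, by positivity,
      (min_le_right _ _).trans_lt (by linarith), fun i s hs => ?_, fun i s hs => ?_⟩
    · have hs' : dist s 0 < ε := by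
        rw [dist_zero_right]; linarith [min_le_left (ε / 2) (R / 2)]
      refine ((hball hs').1 i).trans ?_
      gcongr
      have h3 : |c i| ≤ ∑ i, |c i| :=
        Finset.single_le_sum (f := fun i => |c i|) (fun _ _ => abs_nonneg _) (Finset.mem_univ i)
      have h4 : 0 ≤ ∑ i, (‖δ i 0‖ + 1) := by positivity
      linarith [le_abs_self (c i)]
    · have hs' : dist s 0 < ε := by
        rw [dist_zero_right]; linarith [min_le_left (ε / 2) (R / 2)]
      refine ((hball hs').2 i).trans ?_
      have h3 : ‖δ i 0‖ + 1 ≤ ∑ i, (‖δ i 0‖ + 1) :=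
        Finset.single_le_sum (f := fun i => ‖δ i 0‖ + 1) (fun _ _ => by positivity)
          (Finset.mem_univ i)
      have h4 : 0 ≤ ∑ i, |c i| := by positivity
      linarith
  set E := Real.exp (L * r)
  set C₁ := ∑ l, (κ' l).factorial * E / r ^ κ' l
  set C₂ := ∑ l, (κ l).factorial * 2 / (r / 2) ^ κ l
  set N := ∑ l, κ' l
  set A := Real.log (L * C₁ + 1) + 1
  set B := (C₂ * A + 2 * C₂ * N + 1) ^ 2
  have hC₁ : 0 ≤ C₁ := by positivity
  have hC₂ : 0 ≤ C₂ := by positivity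
  have hlogL : 0 ≤ Real.log (L * C₁ + 1) := Real.log_nonneg (by nlinarith)
  have hA : 0 < A := by positivity
  refine ⟨B + C₁ * (1 + B) ^ N, fun X Y hX hY h0 hexp => ?_⟩
  set S := ∑ i, ‖X i‖
  have hS : 0 ≤ S := by positivity
  set f : ℂ → ℂ := fun s => ∑ i, β i s * X i with hf
  set g : ℂ → ℂ := fun s => ∑ i, δ i s * Y i with hg
  have hfd : DifferentiableOn ℂ f (ball 0 R) := by rw [hf]; fun_prop
  have hgd : DifferentiableOn ℂ g (ball 0 R) := by rw [hg]; fun_prop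
  have hclosed : ∀ ρ ≤ r, closedBall (0 : ℂ) ρ ⊆ ball 0 R := fun ρ hρ =>
    Metric.closedBall_subset_ball (hρ.trans_lt hrR)
  have hYsum : ∑ l, ‖Y l‖ ≤ C₁ * (1 + S) ^ N := by
    have hρ : 0 < r / (1 + S) := by positivity
    have hρr : r / (1 + S) ≤ r := div_le_self hr.le (by linarith)
    rw [Finset.sum_mul]
    refine Finset.sum_le_sum fun l _ => ?_
    have hYl : Y l = iteratedDeriv (κ' l) g 0 := by
      rw [hg, iteratedDeriv_sum_mul_const hR hδ]; exact hY l
    have hbound : ∀ z ∈ Metric.sphere (0 : ℂ) (r / (1 + S)), ‖g z‖ ≤ E := by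
      intro z hz
      rw [mem_sphere_zero_iff_norm] at hz
      have hzr : ‖z‖ ≤ r := hz.trans_le hρr
      rw [hg]
      change ‖∑ i, δ i z * Y i‖ ≤ E
      rw [hexp z (hclosed r le_rfl (by simpa using hzr)), Complex.norm_exp]
      refine Real.exp_le_exp.mpr ((Complex.re_le_norm _).trans ?_)
      have : ∑ i, β i z * X i = ∑ i, (β i z - β i 0) * X i := by
        simp_rw [sub_mul, Finset.sum_sub_distrib, h0, sub_zero]
      rw [this]
      calc ‖∑ i, (β i z - β i 0) * X i‖ ≤ ∑ i, L * ‖z‖ * ‖X i‖ := by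
            refine norm_sum_le_of_le _ fun i _ => ?_
            rw [norm_mul]
            gcongr
            exact hLβ i z hzr
        _ = L * (r / (1 + S) * S) := by rw [← Finset.mul_sum, hz]; ring
        _ ≤ L * r := by
            gcongr
            rw [div_mul_eq_mul_div, div_le_iff₀ (by positivity)]
            nlinarith
    rw [hYl]
    refine (Complex.norm_iteratedDeriv_le_of_forall_mem_sphere_norm_le (κ' l) hρ
      ((hgd.mono (hclosed _ hρr)).diffContOnCl_ball subset_rfl) hbound).trans ?_
    have hκN : κ' l ≤ N := Finset.single_le_sum (fun _ _ => Nat.zero_le _) (Finset.mem_univ l)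
    calc (κ' l).factorial * E / (r / (1 + S)) ^ κ' l
        = (κ' l).factorial * E / r ^ κ' l * (1 + S) ^ κ' l := by
          rw [div_pow]; field_simp
      _ ≤ (κ' l).factorial * E / r ^ κ' l * (1 + S) ^ N := by
          gcongr
          linarith
  set M := A + N * Real.log (1 + S)
  have hlogS : 0 ≤ Real.log (1 + S) := Real.log_nonneg (by linarith)
  have hM : 0 < M := by positivity
  have hre : Set.MapsTo f (ball 0 r) {z | z.re ≤ M} := by
    intro z hz
    have hzr : ‖z‖ ≤ r := (mem_ball_zero_iff.mp hz).le
    have h1 : Real.exp (f z).re ≤ (L * C₁ + 1) * (1 + S) ^ N := by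
      rw [← Complex.norm_exp, hf]
      change ‖exp (∑ i, β i z * X i)‖ ≤ _
      rw [← hexp z (hclosed r le_rfl (by simpa using hzr))]
      calc ‖∑ i, δ i z * Y i‖ ≤ ∑ i, L * ‖Y i‖ := by
            refine norm_sum_le_of_le _ fun i _ => ?_
            rw [norm_mul]
            gcongr
            exact hLδ i z hzr
        _ ≤ L * (C₁ * (1 + S) ^ N) := by rw [← Finset.mul_sum]; gcongr
        _ ≤ (L * C₁ + 1) * (1 + S) ^ N := by
            have : 0 ≤ (1 + S) ^ N := by positivity
            linarith
    have hLC : 0 < L * C₁ + 1 := add_pos_of_nonneg_of_pos (mul_nonneg hL hC₁) one_pos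
    have hSN : 0 < (1 + S) ^ N := pow_pos (by linarith) N
    have h2 := (Real.le_log_iff_exp_le (mul_pos hLC hSN)).mpr h1
    rw [Real.log_mul hLC.ne' hSN.ne', Real.log_pow] at h2
    change (f z).re ≤ Real.log (L * C₁ + 1) + 1 + N * Real.log (1 + S)
    linarith
  have hXS : S ≤ C₂ * M := by
    change ∑ l, ‖X l‖ ≤ _
    rw [Finset.sum_mul]
    refine Finset.sum_le_sum fun l _ => ?_
    have hXl : X l = iteratedDeriv (κ l) f 0 := by
      rw [hf, iteratedDeriv_sum_mul_const hR hβ]; exact hX l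
    have hbound : ∀ z ∈ Metric.sphere (0 : ℂ) (r / 2), ‖f z‖ ≤ 2 * M := by
      intro z hz
      rw [mem_sphere_zero_iff_norm] at hz
      have := Complex.borelCaratheodory_zero hM
        (hfd.mono (Metric.ball_subset_ball hrR.le)) hre hr (z := z)
        (by rw [mem_ball_zero_iff, hz]; linarith) h0
      rw [hz] at this
      refine this.trans_eq ?_
      field_simp
      ring
    rw [hXl]
    refine (Complex.norm_iteratedDeriv_le_of_forall_mem_sphere_norm_le (κ l) (half_pos hr)
      ((hfd.mono (hclosed _ (by linarith))).diffContOnCl_ball subset_rfl) hbound).trans_eq ?_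
    ring
  have hSB : S ≤ B := le_sq_of_le_mul_add_log hS hC₂ hA.le (Nat.cast_nonneg N) hXS
  have hB : 0 ≤ B := hS.trans hSB
  constructor
  · intro i
    have h1 : ‖X i‖ ≤ S :=
      Finset.single_le_sum (f := fun i => ‖X i‖) (fun _ _ => norm_nonneg _) (Finset.mem_univ i)
    have h2 : 0 ≤ C₁ * (1 + B) ^ N := mul_nonneg hC₁ (pow_nonneg (by linarith) N)
    linarith
  · intro i
    have h1 : ‖Y i‖ ≤ ∑ l, ‖Y l‖ :=
      Finset.single_le_sum (f := fun i => ‖Y i‖) (fun _ _ => norm_nonneg _) (Finset.mem_univ i)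
    have h2 : C₁ * (1 + S) ^ N ≤ C₁ * (1 + B) ^ N :=
      mul_le_mul_of_nonneg_left (pow_le_pow_left₀ (by linarith) (by linarith) N) hC₁
    linarith

/-- Normal form of a finite-rank function `(t, s) ↦ ∑ a i t * d i s` that is holomorphic in `s`:
the coefficients `H l` can be taken to be derivatives of the function at `s = 0`. -/
theorem exists_normalForm_of_finiteRank {T ι : Type*} [Fintype ι] {R : ℝ} (hR : 0 < R)
    (a : ι → T → ℂ) (d : ι → ℂ → ℂ) (hd : ∀ j, DifferentiableOn ℂ (d j) (ball 0 R)) :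
    ∃ (m : ℕ) (κ : Fin m → ℕ) (δ : Fin m → ℂ → ℂ) (H : Fin m → T → ℂ),
      (∀ i, DifferentiableOn ℂ (δ i) (ball 0 R)) ∧
      (∀ t, ∀ s ∈ ball (0 : ℂ) R, ∑ j, a j t * d j s = ∑ l, δ l s * H l t) ∧
      (∀ l, H l = ∑ i, iteratedDeriv (κ l) (δ i) 0 • H i) ∧
      ∀ l, ∃ v : ι → ℂ, H l = fun t => ∑ j, a j t * v j := by
  obtain ⟨m, κ, δ, hδ, hd'⟩ := exists_eq_sum_mul_iteratedDeriv d hd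
  have hrep : ∀ t, ∀ s ∈ ball (0 : ℂ) R, ∑ j, a j t * d j s =
      ∑ l, δ l s * ∑ j, a j t * iteratedDeriv (κ l) (d j) 0 := by
    intro t s hs
    simp_rw [fun j => hd' j s hs, Finset.mul_sum]
    rw [Finset.sum_comm]
    exact Finset.sum_congr rfl fun l _ => Finset.sum_congr rfl fun j _ => by ring
  refine ⟨m, κ, δ, fun l t => ∑ j, a j t * iteratedDeriv (κ l) (d j) 0, hδ, hrep, fun l => ?_,
    fun l => ⟨_, rfl⟩⟩
  ext t
  have h1 : iteratedDeriv (κ l) (fun s => ∑ j, d j s * a j t) 0 = iteratedDeriv (κ l)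
      (fun s => ∑ l, δ l s * ∑ j, a j t * iteratedDeriv (κ l) (d j) 0) 0 := by
    refine Filter.EventuallyEq.iteratedDeriv_eq _ ?_
    filter_upwards [Metric.ball_mem_nhds 0 hR] with s hs
    rw [← hrep t s hs]
    simp_rw [mul_comm]
  rw [iteratedDeriv_sum_mul_const hR hd, iteratedDeriv_sum_mul_const hR hδ] at h1
  simpa [mul_comm] using h1

theorem eq_of_forall_isRoot {T : Type*} [TopologicalSpace T] [PreconnectedSpace T] {u : T → ℂ}
    (hu : Continuous u) {P : Polynomial ℂ} (hP : P ≠ 0) (h : ∀ t, P.IsRoot (u t)) (t t' : T) :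
    u t = u t' := by
  by_contra hne
  have hpre : IsPreconnected (Set.range u) := isPreconnected_range hu
  have hnt : (Set.range u).Nontrivial := ⟨_, ⟨t, rfl⟩, _, ⟨t', rfl⟩, hne⟩
  refine hpre.infinite_of_nontrivial hnt ((Polynomial.finite_setOfPred_isRoot hP).subset ?_)
  rintro _ ⟨x, rfl⟩
  exact h x

/-- If `g' = f' * g` on a disc, `f 0 = 0` and `g 0 = 1`, then `g = exp f` there. -/
theorem eqOn_exp_of_deriv_eq_mul {R : ℝ} {f g : ℂ → ℂ}
    (hf : DifferentiableOn ℂ f (ball 0 R)) (hg : DifferentiableOn ℂ g (ball 0 R))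
    (hf0 : f 0 = 0) (hg0 : g 0 = 1)
    (h : ∀ s ∈ ball (0 : ℂ) R, deriv g s = deriv f s * g s) :
    ∀ s ∈ ball (0 : ℂ) R, g s = exp (f s) := by
  intro s hs
  have hR : 0 < R := (norm_nonneg s).trans_lt (mem_ball_zero_iff.mp hs)
  have hd : ∀ x ∈ ball (0 : ℂ) R, HasDerivAt (fun s => g s * exp (-f s)) 0 x := by
    intro x hx
    have h1 := (hf.differentiableAt (Metric.isOpen_ball.mem_nhds hx)).hasDerivAt
    have h2 := (hg.differentiableAt (Metric.isOpen_ball.mem_nhds hx)).hasDerivAt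
    refine (h2.fun_mul h1.fun_neg.cexp).congr_deriv ?_
    rw [h x hx]
    ring
  have hconst := Metric.isOpen_ball.is_const_of_deriv_eq_zero
    (convex_ball (0 : ℂ) R).isPreconnected
    (fun x hx => (hd x hx).differentiableAt.differentiableWithinAt)
    (fun x hx => (hd x hx).deriv) hs (Metric.mem_ball_self hR)
  simp only [hf0, hg0, neg_zero, exp_zero, mul_one] at hconst
  rwa [exp_neg, mul_inv_eq_one₀ (exp_ne_zero _)] at hconst

/-- If `F` and `exp F` are both functions of finite rank of `(t, s)`, holomorphic in `s`, and
`F` vanishes for `s = 0`, then `F` does not depend on `t`. -/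
theorem eq_of_finiteRank_exp {T ι ι' : Type*} [TopologicalSpace T] [PreconnectedSpace T]
    [Fintype ι] [Fintype ι'] {R : ℝ} (hR : 0 < R)
    (a : ι → T → ℂ) (ha : ∀ i, Continuous (a i))
    (b : ι → ℂ → ℂ) (hb : ∀ i, DifferentiableOn ℂ (b i) (ball 0 R))
    (c : ι' → T → ℂ) (d : ι' → ℂ → ℂ) (hd : ∀ i, DifferentiableOn ℂ (d i) (ball 0 R))
    (h0 : ∀ t, ∑ i, a i t * b i 0 = 0)
    (hexp : ∀ t, ∀ s ∈ ball (0 : ℂ) R, ∑ j, c j t * d j s = exp (∑ i, a i t * b i s))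
    (t t' : T) {s : ℂ} (hs : s ∈ ball (0 : ℂ) R) :
    ∑ i, a i t * b i s = ∑ i, a i t' * b i s := by
  have : Nonempty T := ⟨t⟩
  have hball : (0 : ℂ) ∈ ball (0 : ℂ) R := Metric.mem_ball_self hR
  obtain ⟨m, κ, β, H, hβ, hF, hH, hHa⟩ := exists_normalForm_of_finiteRank hR a b hb
  obtain ⟨m', κ', δ, G, hδ, hG, hG', -⟩ := exists_normalForm_of_finiteRank hR c d hd
  set gen : Set (T → ℂ) := Set.range H ∪ Set.range G
  have hgenfin : gen.Finite := (Set.finite_range H).union (Set.finite_range G)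
  let A := Algebra.adjoin ℂ gen
  let HA : Fin m → A := fun l => ⟨H l, Algebra.subset_adjoin (Or.inl ⟨l, rfl⟩)⟩
  let GA : Fin m' → A := fun l => ⟨G l, Algebra.subset_adjoin (Or.inr ⟨l, rfl⟩)⟩
  have hHA : ∀ l, HA l = ∑ i, iteratedDeriv (κ l) (β i) 0 • HA i := fun l =>
    Subtype.ext (by simpa [HA] using hH l)
  have hGA : ∀ l, GA l = ∑ i, iteratedDeriv (κ' l) (δ i) 0 • GA i := fun l =>
    Subtype.ext (by simpa [GA] using hG' l)
  have hH0 : ∑ i, β i 0 • HA i = 0 := Subtype.ext (by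
    ext t
    simpa [HA, hF t 0 hball] using h0 t)
  have hG1 : ∑ i, δ i 0 • GA i = 1 := Subtype.ext (by
    ext t
    have := hexp t 0 hball
    rw [h0, hG t 0 hball, exp_zero] at this
    simpa [GA] using this)
  have hode : ∀ s ∈ ball (0 : ℂ) R, ∑ i, deriv (δ i) s • GA i =
      (∑ i, deriv (β i) s • HA i) * ∑ i, δ i s • GA i := by
    intro s hs
    refine Subtype.ext ?_
    ext t
    have hβs : ∀ i, HasDerivAt (β i) (deriv (β i) s) s := fun i =>
      ((hβ i).differentiableAt (Metric.isOpen_ball.mem_nhds hs)).hasDerivAt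
    have hδs : ∀ i, HasDerivAt (δ i) (deriv (δ i) s) s := fun i =>
      ((hδ i).differentiableAt (Metric.isOpen_ball.mem_nhds hs)).hasDerivAt
    have h1 : HasDerivAt (fun s => ∑ i, δ i s * G i t) (∑ i, deriv (δ i) s * G i t) s :=
      HasDerivAt.fun_sum fun i _ => (hδs i).mul_const _
    have h2 : HasDerivAt (fun s => ∑ i, β i s * H i t) (∑ i, deriv (β i) s * H i t) s :=
      HasDerivAt.fun_sum fun i _ => (hβs i).mul_const _
    have h3 : ∀ s ∈ ball (0 : ℂ) R, ∑ i, δ i s * G i t = exp (∑ i, β i s * H i t) := by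
      intro s hs
      rw [← hG t s hs, ← hF t s hs, hexp t s hs]
    have h4 : HasDerivAt (fun s => ∑ i, δ i s * G i t)
        (exp (∑ i, β i s * H i t) * ∑ i, deriv (β i) s * H i t) s :=
      h2.cexp.congr_of_eventuallyEq
        (Filter.mem_of_superset (Metric.isOpen_ball.mem_nhds hs) h3)
    have h5 := h1.unique h4
    rw [← h3 s hs, mul_comm] at h5
    simpa [HA, GA] using h5
  obtain ⟨C, hC⟩ := exists_forall_norm_le_of_eq_exp hR κ β hβ κ' δ hδ
  have hbound : ∀ χ : A →ₐ[ℂ] ℂ, (∀ i, ‖χ (HA i)‖ ≤ C) ∧ ∀ i, ‖χ (GA i)‖ ≤ C := by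
    intro χ
    have hχ0 : ∑ i, β i 0 * χ (HA i) = 0 := by simpa using congrArg χ hH0
    refine hC _ _ (fun l => by simpa using congrArg χ (hHA l))
      (fun l => by simpa using congrArg χ (hGA l)) hχ0 ?_
    refine eqOn_exp_of_deriv_eq_mul (by fun_prop) (by fun_prop) hχ0
      (by simpa using congrArg χ hG1) fun s hs => ?_
    have hβs : ∀ i, DifferentiableAt ℂ (β i) s := fun i =>
      (hβ i).differentiableAt (Metric.isOpen_ball.mem_nhds hs)
    have hδs : ∀ i, DifferentiableAt ℂ (δ i) s := fun i =>
      (hδ i).differentiableAt (Metric.isOpen_ball.mem_nhds hs)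
    rw [(HasDerivAt.fun_sum fun i _ => (hδs i).hasDerivAt.mul_const (χ (GA i))).deriv,
      (HasDerivAt.fun_sum fun i _ => (hβs i).hasDerivAt.mul_const (χ (HA i))).deriv]
    simpa using congrArg χ (hode s hs)
  have hint : Algebra.IsIntegral ℂ A := by
    refine isIntegral_of_forall_character_norm_le (S := (Subtype.val : A → T → ℂ) ⁻¹' gen)
      (hgenfin.preimage Subtype.val_injective.injOn) Algebra.adjoin_adjoin_coe_preimage C ?_
    rintro χ ⟨x, hx⟩ (⟨l, rfl⟩ | ⟨l, rfl⟩)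
    · exact (hbound χ).1 l
    · exact (hbound χ).2 l
  rw [hF t s hs, hF t' s hs]
  refine Finset.sum_congr rfl fun l _ => ?_
  congr 1
  obtain ⟨P, hP, hPl⟩ := hint.isIntegral (HA l)
  refine eq_of_forall_isRoot (u := H l) ?_ hP.ne_zero (fun t => ?_) t t'
  · obtain ⟨v, hv⟩ := hHa l
    rw [hv]
    fun_prop
  · let ev : A →ₐ[ℂ] ℂ := (Pi.evalAlgHom ℂ (fun _ : T => ℂ) t).comp A.val
    have h1 : Polynomial.aeval (ev (HA l)) P = 0 := by
      rw [Polynomial.aeval_algHom_apply, Polynomial.aeval_def, hPl, map_zero]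
    have h2 : P.eval (ev (HA l)) = 0 := by
      simpa [Polynomial.aeval_def, Polynomial.eval₂_id] using h1
    exact h2

/-- The algebra of functions of two variables that are finite sums `∑ a i z * b i w` with `a i`
holomorphic on `U` and `b i` holomorphic on `W`. -/
def separatedHolomorphic {V : Type*} [NormedAddCommGroup V] [NormedSpace ℂ V] (U W : Set V) :
    Subalgebra ℂ (V → V → ℂ) where
  carrier := {H | ∃ (ι : Type) (_ : Fintype ι) (a b : ι → V → ℂ),
    (∀ i, DifferentiableOn ℂ (a i) U) ∧ (∀ i, DifferentiableOn ℂ (b i) W) ∧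
    ∀ z w, H z w = ∑ i, a i z * b i w}
  mul_mem' := by
    rintro H K ⟨ι, _, a, b, ha, hb, hH⟩ ⟨ι', _, a', b', ha', hb', hK⟩
    refine ⟨ι × ι', inferInstance, fun i z => a i.1 z * a' i.2 z, fun i w => b i.1 w * b' i.2 w,
      fun i => (ha _).mul (ha' _), fun i => (hb _).mul (hb' _), fun z w => ?_⟩
    simp only [Pi.mul_apply, hH, hK, Finset.sum_mul_sum, Fintype.sum_prod_type]
    exact Finset.sum_congr rfl fun i _ => Finset.sum_congr rfl fun j _ => by ring
  add_mem' := by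
    rintro H K ⟨ι, _, a, b, ha, hb, hH⟩ ⟨ι', _, a', b', ha', hb', hK⟩
    refine ⟨ι ⊕ ι', inferInstance, Sum.elim a a', Sum.elim b b', ?_, ?_, fun z w => ?_⟩
    · rintro (i | i)
      exacts [ha i, ha' i]
    · rintro (i | i)
      exacts [hb i, hb' i]
    · simp [hH, hK]
  algebraMap_mem' r := ⟨Unit, inferInstance, fun _ _ => r, fun _ _ => 1,
    fun _ => differentiableOn_const _, fun _ => differentiableOn_const _, fun z w => by simp⟩

section Separated

variable {V : Type*} [NormedAddCommGroup V] [NormedSpace ℂ V] {U W : Set V}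

theorem separatedHolomorphic_of_left {u : V → ℂ} (hu : DifferentiableOn ℂ u U) :
    (fun z _ => u z) ∈ separatedHolomorphic U W :=
  ⟨Unit, inferInstance, fun _ => u, fun _ _ => 1, fun _ => hu, fun _ => differentiableOn_const _,
    fun z w => by simp⟩

theorem separatedHolomorphic_of_right {v : V → ℂ} (hv : DifferentiableOn ℂ v W) :
    (fun _ w => v w) ∈ separatedHolomorphic U W :=
  ⟨Unit, inferInstance, fun _ _ => 1, fun _ => v, fun _ => differentiableOn_const _, fun _ => hv,
    fun z w => by simp⟩

theorem differentiableOn_of_mem_separatedHolomorphic {H : V → V → ℂ}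
    (hH : H ∈ separatedHolomorphic U W) :
    DifferentiableOn ℂ (fun x : V × V => H x.1 x.2) (U ×ˢ W) := by
  obtain ⟨ι, _, a, b, ha, hb, hH⟩ := hH
  simp_rw [hH]
  refine DifferentiableOn.fun_sum fun i _ => DifferentiableOn.mul ?_ ?_
  · exact (ha i).comp differentiableOn_fst fun x hx => hx.1
  · exact (hb i).comp differentiableOn_snd fun x hx => hx.2

theorem eq_const_of_exp_eq_of_separatedHolomorphic {p q : V} {ε : ℝ} {F G : V → V → ℂ}
    (hF : F ∈ separatedHolomorphic (ball p ε) (ball q ε))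
    (hG : G ∈ separatedHolomorphic (ball p ε) (ball q ε))
    (hexp : ∀ z ∈ ball p ε, ∀ w ∈ ball q ε, exp (F z w) = G z w) {c : ℂ}
    (hq : ∀ z ∈ ball p ε, F z q = c) (hp : ∀ w ∈ ball q ε, F p w = c) :
    ∀ z ∈ ball p ε, ∀ w ∈ ball q ε, F z w = c := by
  intro z hz w hw
  have hε : 0 < ε := dist_nonneg.trans_lt hz
  obtain ⟨R, hR1, hR⟩ : ∃ R : ℝ, 1 < R ∧ R * ‖w - q‖ < ε := by
    have h1 : ∀ᶠ R in 𝓝[>] (1 : ℝ), R * ‖w - q‖ < ε := by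
      have : Tendsto (fun R : ℝ => R * ‖w - q‖) (𝓝[>] 1) (𝓝 (1 * ‖w - q‖)) :=
        (tendsto_id.mul_const _).mono_left nhdsWithin_le_nhds
      refine this.eventually (gt_mem_nhds ?_)
      rw [one_mul, ← dist_eq_norm]; exact hw
    obtain ⟨R, h2, h3⟩ := (h1.and self_mem_nhdsWithin).exists
    exact ⟨R, h3, h2⟩
  have hline : Set.MapsTo (fun s : ℂ => q + s • (w - q)) (ball 0 R) (ball q ε) := by
    intro s hs
    rw [mem_ball_zero_iff] at hs
    rw [mem_ball_iff_norm, add_sub_cancel_left, norm_smul]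
    exact (mul_le_mul_of_nonneg_right hs.le (norm_nonneg _)).trans_lt hR
  have hlined : DifferentiableOn ℂ (fun s : ℂ => q + s • (w - q)) (ball 0 R) := by fun_prop
  obtain ⟨ι, _, a, b, ha, hb, hFab⟩ := Subalgebra.sub_mem _ hF (Subalgebra.algebraMap_mem _ c)
  obtain ⟨ι', _, a', b', ha', hb', hGab⟩ := Subalgebra.mul_mem _ hG
    (Subalgebra.algebraMap_mem _ (exp (-c)))
  have hFab' : ∀ z w, F z w - c = ∑ i, a i z * b i w := fun z w => by
    rw [← hFab]; simp [Algebra.algebraMap_eq_smul_one]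
  have hGab' : ∀ z w, G z w * exp (-c) = ∑ i, a' i z * b' i w := fun z w => by
    rw [← hGab]; simp [Algebra.algebraMap_eq_smul_one]
  have : PreconnectedSpace (ball p ε) := by
    let := NormedSpace.restrictScalars ℝ ℂ V
    exact isPreconnected_iff_preconnectedSpace.mp (convex_ball p ε).isPreconnected
  have key := eq_of_finiteRank_exp (T := ball p ε) (zero_lt_one.trans hR1)
    (fun i z => a i z) (fun i => (ha i).continuousOn.domRestrict)
    (fun i s => b i (q + s • (w - q))) (fun i => (hb i).comp hlined hline)
    (fun i z => a' i z) (fun i s => b' i (q + s • (w - q)))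
    (fun i => (hb' i).comp hlined hline)
    (fun z => by rw [← hFab']; simp [hq z z.2])
    (fun z s hs => by
      refine (hGab' z (q + s • (w - q))).symm.trans (Eq.trans ?_
        (congrArg exp (hFab' z (q + s • (w - q)))))
      rw [← hexp z z.2 _ (hline hs), ← exp_add]
      simp only [← sub_eq_add_neg])
    ⟨z, hz⟩ ⟨p, Metric.mem_ball_self hε⟩ (s := 1) (by simpa using hR1)
  simp only [one_smul, add_sub_cancel] at key
  rw [← hFab', ← hFab', hp w hw, sub_self, sub_eq_zero] at key
  exact key

end Separated

theorem eq_zero_of_forall_ofReal_eq_zero {R : ℝ} {k : ℂ → ℂ}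
    (hk : DifferentiableOn ℂ k (ball 0 R)) (h : ∀ x : ℝ, |x| < R → k x = 0) {s : ℂ}
    (hs : s ∈ ball (0 : ℂ) R) : k s = 0 := by
  have hR : 0 < R := (norm_nonneg s).trans_lt (mem_ball_zero_iff.mp hs)
  refine (hk.analyticOnNhd Metric.isOpen_ball).eqOn_zero_of_preconnected_of_frequently_eq_zero
    (convex_ball (0 : ℂ) R).isPreconnected (Metric.mem_ball_self hR) ?_ hs
  have ht : Tendsto (fun x : ℝ => (x : ℂ)) (𝓝[≠] 0) (𝓝[≠] 0) := by
    refine tendsto_nhdsWithin_iff.mpr ⟨?_, ?_⟩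
    · exact (Complex.continuous_ofReal.tendsto' 0 0 (by simp)).mono_left nhdsWithin_le_nhds
    · filter_upwards [self_mem_nhdsWithin] with x hx
      simpa using hx
  refine ht.frequently (Filter.Eventually.frequently ?_)
  refine nhdsWithin_le_nhds ?_
  filter_upwards [Metric.ball_mem_nhds (0 : ℝ) hR] with x hx
  exact h x (by simpa using hx)

/-- A holomorphic function of `(z, w)` vanishing on the totally real set `w = star z` vanishes. -/
theorem eq_zero_of_forall_star_eq_zero {n : ℕ} {p : Fin n → ℂ} {ε : ℝ}
    {H : (Fin n → ℂ) → (Fin n → ℂ) → ℂ}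
    (hH : DifferentiableOn ℂ (fun x : (Fin n → ℂ) × (Fin n → ℂ) => H x.1 x.2)
      (ball p ε ×ˢ ball (star p) ε))
    (h0 : ∀ z ∈ ball p ε, H z (star z) = 0) :
    ∀ z ∈ ball p (ε / 4), ∀ w ∈ ball (star p) (ε / 4), H z w = 0 := by
  intro z hz w hw
  rw [mem_ball_iff_norm] at hz hw
  set ζ : Fin n → ℂ := (1 / 2 : ℂ) • ((z - p) + star (w - star p)) with hζ
  set η : Fin n → ℂ := (1 / (2 * I) : ℂ) • ((z - p) - star (w - star p)) with hη
  have hstarw : ‖star (w - star p)‖ < ε / 4 := by rwa [norm_star]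
  have hζn : ‖ζ‖ < ε / 4 := by
    rw [hζ, norm_smul]
    have := norm_add_le (z - p) (star (w - star p))
    have h2 : ‖(1 / 2 : ℂ)‖ = 1 / 2 := by simp
    rw [h2]
    linarith
  have hηn : ‖η‖ < ε / 4 := by
    rw [hη, norm_smul]
    have := norm_sub_le (z - p) (star (w - star p))
    have h2 : ‖(1 / (2 * I) : ℂ)‖ = 1 / 2 := by simp
    rw [h2]
    linarith
  have hsmall : ∀ (s t : ℂ) (x y : Fin n → ℂ), ‖x‖ < ε / 4 → ‖y‖ < ε / 4 → ‖s‖ < 2 → ‖t‖ < 2 →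
      ‖s • x + t • y‖ < ε := by
    intro s t x y hx hy hs ht
    refine (norm_add_le _ _).trans_lt ?_
    rw [norm_smul, norm_smul]
    nlinarith [norm_nonneg s, norm_nonneg t, norm_nonneg x, norm_nonneg y]
  let e : ℂ → ℂ → (Fin n → ℂ) × (Fin n → ℂ) := fun s t =>
    (p + (s • ζ + t • η), star p + (s • star ζ + t • star η))
  have hmaps : ∀ s t : ℂ, ‖s‖ < 2 → ‖t‖ < 2 → e s t ∈ ball p ε ×ˢ ball (star p) ε := by
    intro s t hs ht
    constructor
    · simpa [e] using hsmall s t ζ η hζn hηn hs ht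
    · have := hsmall s t (star ζ) (star η) (by rwa [norm_star]) (by rwa [norm_star]) hs ht
      simpa only [e, mem_ball_iff_norm, add_sub_cancel_left] using this
  have hreal : ∀ x y : ℝ, |x| < 2 → |y| < 2 → H (e x y).1 (e x y).2 = 0 := by
    intro x y hx hy
    have h1 : (e x y).2 = star (e x y).1 := by
      simp [e, star_add, star_smul]
    rw [h1]
    exact h0 _ (hmaps x y (by simpa using hx) (by simpa using hy)).1
  have hleft : ∀ s : ℂ, ‖s‖ < 2 → ∀ y : ℝ, |y| < 2 → H (e s y).1 (e s y).2 = 0 := by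
    intro s hs y hy
    refine eq_zero_of_forall_ofReal_eq_zero (R := 2) (k := fun s => H (e s y).1 (e s y).2) ?_
      (fun x hx => hreal x y hx hy) (by simpa using hs)
    exact hH.comp (f := fun s => e s y) (by fun_prop)
      fun s hs => hmaps s y (by simpa using hs) (by simpa using hy)
  have hall : H (e 1 I).1 (e 1 I).2 = 0 := by
    refine eq_zero_of_forall_ofReal_eq_zero (R := 2) (k := fun t => H (e 1 t).1 (e 1 t).2) ?_
      (fun y hy => hleft 1 (by simp) y hy) (by simp)
    exact hH.comp (f := fun t => e 1 t) (by fun_prop)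
      fun t ht => hmaps 1 t (by simp) (by simpa using ht)
  have hI : I ≠ 0 := I_ne_zero
  have he1 : (e 1 I).1 = z := by
    ext j
    simp [e, hζ, hη]
    field_simp
    ring_nf
    linear_combination ((starRingEnd ℂ) (w j) - z j) * I_sq
  have he2 : (e 1 I).2 = w := by
    ext j
    simp [e, hζ, hη]
    field_simp
    ring_nf
    linear_combination ((starRingEnd ℂ) (z j) - w j) * I_sq
  rwa [he1, he2] at hall

/-- The holomorphic partial derivative in the `a`-th coordinate. -/
noncomputable def holoPartial {n : ℕ} (a : Fin n) (u : (Fin n → ℂ) → ℂ) (z : Fin n → ℂ) : ℂ :=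
  fderiv ℂ u z (Pi.single a 1)

/-- The Hermitian-type form `∑ c i * (u i z * v i w)` in independent variables `z` and `w`. -/
def polarized {V ι : Type*} [Fintype ι] (c : ι → ℂ) (u v : ι → V → ℂ) (z w : V) : ℂ :=
  ∑ i, c i * (u i z * v i w)

theorem polarized_mem_separatedHolomorphic {V ι : Type*} [NormedAddCommGroup V] [NormedSpace ℂ V]
    [Fintype ι] {U W : Set V} (c : ι → ℂ) {u v : ι → V → ℂ}
    (hu : ∀ i, DifferentiableOn ℂ (u i) U) (hv : ∀ i, DifferentiableOn ℂ (v i) W) :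
    polarized c u v ∈ separatedHolomorphic U W := by
  have : polarized c u v = ∑ i, algebraMap ℂ (V → V → ℂ) (c i) *
      ((fun z _ => u i z) * fun _ w => v i w) := by
    ext z w
    simp [polarized]
  rw [this]
  exact Subalgebra.sum_mem _ fun i _ => Subalgebra.mul_mem _ (Subalgebra.algebraMap_mem _ _)
    (Subalgebra.mul_mem _ (separatedHolomorphic_of_left (hu i))
      (separatedHolomorphic_of_right (hv i)))

section Wirtinger

variable {n : ℕ} {ι : Type*} [Fintype ι] {c : ι → ℂ} {u v : ι → (Fin n → ℂ) → ℂ} {z : Fin n → ℂ}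

theorem AnalyticAt.holoPartial {f : (Fin n → ℂ) → ℂ} (hf : AnalyticAt ℂ f z) (a : Fin n) :
    AnalyticAt ℂ (holoPartial a f) z :=
  ((ContinuousLinearMap.apply ℂ ℂ (Pi.single a 1 : Fin n → ℂ)).analyticAt _).comp hf.fderiv

theorem fderiv_polarized_star (hu : ∀ i, DifferentiableAt ℂ (u i) z)
    (hv : ∀ i, DifferentiableAt ℂ (v i) z) (x : Fin n → ℂ) :
    fderiv ℝ (fun z => polarized c u (fun i => star ∘ v i ∘ star) z (star z)) z x =
      ∑ i, c i * (u i z * star (fderiv ℂ (v i) z x) + fderiv ℂ (u i) z x * star (v i z)) := by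
  have h1 : (fun z => polarized c u (fun i => star ∘ v i ∘ star) z (star z)) =
      fun z => ∑ i, c i * (u i z * conjCLE (v i z)) := by
    ext z
    simp [polarized]
  have h2 : HasFDerivAt (𝕜 := ℝ) (fun z => ∑ i, c i * (u i z * conjCLE (v i z))) _ z :=
    HasFDerivAt.fun_sum fun i _ => HasFDerivAt.const_mul
      (((hu i).hasFDerivAt.restrictScalars ℝ).mul
        ((conjCLE : ℂ →L[ℝ] ℂ).hasFDerivAt.comp z ((hv i).hasFDerivAt.restrictScalars ℝ))) (c i)
  rw [h1, h2.fderiv]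
  simp [mul_comm, mul_add]

theorem fderiv_single_one (f : (Fin n → ℂ) → ℂ) (a : Fin n) :
    fderiv ℂ f z (Pi.single a 1) = holoPartial a f z := rfl

theorem fderiv_single_I (f : (Fin n → ℂ) → ℂ) (a : Fin n) :
    fderiv ℂ f z (Pi.single a I) = I * holoPartial a f z := by
  rw [holoPartial, ← smul_eq_mul, ← map_smul, ← Pi.single_smul, smul_eq_mul, mul_one]

theorem wderiv_polarized_star (hu : ∀ i, DifferentiableAt ℂ (u i) z)
    (hv : ∀ i, DifferentiableAt ℂ (v i) z) (a : Fin n) :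
    wderiv a (fun z => polarized c u (fun i => star ∘ v i ∘ star) z (star z)) z =
      polarized c (fun i => holoPartial a (u i)) (fun i => star ∘ v i ∘ star) z (star z) := by
  rw [wderiv, fderiv_polarized_star hu hv, fderiv_polarized_star hu hv]
  simp only [fderiv_single_I, fderiv_single_one, polarized, Finset.mul_sum,
    ← Finset.sum_sub_distrib, Function.comp, star_star, star_mul]
  refine Finset.sum_congr rfl fun i _ => ?_
  rw [show star I = -I from conj_I]
  linear_combination (-(1 / 2) * c i * (holoPartial a (u i) z * star (v i z) -
    u i z * star (holoPartial a (v i) z))) * I_sq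

theorem wderivBar_polarized_star (hu : ∀ i, DifferentiableAt ℂ (u i) z)
    (hv : ∀ i, DifferentiableAt ℂ (v i) z) (a : Fin n) :
    wderivBar a (fun z => polarized c u (fun i => star ∘ v i ∘ star) z (star z)) z =
      polarized c u (fun i => star ∘ holoPartial a (v i) ∘ star) z (star z) := by
  rw [wderivBar, fderiv_polarized_star hu hv, fderiv_polarized_star hu hv]
  simp only [fderiv_single_I, fderiv_single_one, polarized, Finset.mul_sum,
    ← Finset.sum_add_distrib, Function.comp, star_star, star_mul]
  refine Finset.sum_congr rfl fun i _ => ?_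
  rw [show star I = -I from conj_I]
  linear_combination ((1 / 2) * c i * (holoPartial a (u i) z * star (v i z) -
    u i z * star (holoPartial a (v i) z))) * I_sq

theorem holoPartial_star_star {f : (Fin n → ℂ) → ℂ} (hf : DifferentiableAt ℂ f (star z))
    (a : Fin n) : holoPartial a (star ∘ f ∘ star) z = star (holoPartial a f (star z)) := by
  have := hf.hasFDerivAt.star_star.fderiv
  rw [star_star] at this
  rw [holoPartial, this]
  simp [holoPartial, Pi.star_single]

end Wirtinger

section Gradient

variable {n : ℕ} {ι : Type*} [Fintype ι] {α : ι → (Fin n → ℂ) → ℂ} {p : Fin n → ℂ}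

theorem sum_holoPartial_mul_eq_of_fderiv_eq_zero (hα : ∀ i, DifferentiableAt ℂ (α i) p)
    (γ : ι → ℂ) (κ : Fin n → ℂ) {R : (Fin n → ℂ) → ℂ}
    (hR : R =ᶠ[𝓝 p] fun z => ∑ i, α i z * γ i - ∑ j, (z j - p j) * κ j)
    (h0 : fderiv ℂ R p = 0) (a : Fin n) : ∑ i, holoPartial a (α i) p * γ i = κ a := by
  have h1 : HasFDerivAt (𝕜 := ℂ) (fun z => ∑ i, α i z * γ i - ∑ j, (z j - p j) * κ j) _ p :=
    (HasFDerivAt.fun_sum fun i _ => (hα i).hasFDerivAt.mul_const (γ i)).sub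
      (HasFDerivAt.fun_sum fun j _ => ((hasFDerivAt_apply (𝕜 := ℂ) j p).sub_const _).mul_const _)
  rw [hR.fderiv_eq, h1.fderiv] at h0
  have h2 := congrArg (fun L : (Fin n → ℂ) →L[ℂ] ℂ => L (Pi.single a 1)) h0
  simp [Pi.single_apply, sub_eq_zero] at h2
  simpa [holoPartial, mul_comm] using h2

theorem sum_holoPartial_mul_eq_of_eventuallyEq (hα : ∀ i, DifferentiableAt ℂ (α i) p)
    (γ : ι → ℂ) (a : Fin n) (k : ℂ)
    (h : (fun z => ∑ i, α i z * γ i) =ᶠ[𝓝 p] fun z => z a - k) (b : Fin n) :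
    ∑ i, holoPartial b (α i) p * γ i = if a = b then 1 else 0 := by
  have h1 : HasFDerivAt (𝕜 := ℂ) (fun z => ∑ i, α i z * γ i) _ p :=
    HasFDerivAt.fun_sum fun i _ => (hα i).hasFDerivAt.mul_const (γ i)
  have h2 := h.fderiv_eq (𝕜 := ℂ)
  rw [h1.fderiv, ((hasFDerivAt_apply (𝕜 := ℂ) a p).sub_const k).fderiv] at h2
  have h3 := congrArg (fun L : (Fin n → ℂ) →L[ℂ] ℂ => L (Pi.single b 1)) h2
  simp [Pi.single_apply] at h3
  simpa [holoPartial, mul_comm] using h3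

end Gradient

theorem eventually_eq_of_eventually_exp_eq_one {X : Type*} [TopologicalSpace X] {f : X → ℂ} {x : X}
    (hf : ContinuousAt f x) (h : ∀ᶠ y in 𝓝 x, exp (f y) = 1) : ∀ᶠ y in 𝓝 x, f y = f x := by
  have h1 : ∀ᶠ y in 𝓝 x, dist (f y) (f x) < 2 * Real.pi :=
    hf.eventually (Metric.ball_mem_nhds _ Real.two_pi_pos)
  filter_upwards [h, h1] with y hy hyd
  have h2 : exp (f y - f x) = 1 := by rw [exp_sub, hy, h.self_of_nhds, div_one]
  obtain ⟨m, hm⟩ := Complex.exp_eq_one_iff.mp h2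
  rw [dist_eq_norm, hm] at hyd
  have h3 : (|m| : ℝ) < 1 := by
    have h4 : ‖(m : ℂ) * (2 * Real.pi * I)‖ = |(m : ℝ)| * (2 * Real.pi) := by
      simp [abs_of_pos Real.pi_pos]
    rw [h4] at hyd
    have := Real.two_pi_pos
    nlinarith
  have h5 : m = 0 := by
    have : |m| < 1 := by exact_mod_cast h3
    exact Int.abs_lt_one_iff.mp this
  rw [h5] at hm
  simpa [sub_eq_zero] using hm

section Soliton

variable {n : ℕ} {ι : Type*} [Fintype ι]

/-- The polarization of the soliton potential `-(lam / 2) D - f_X + h + conj h`. -/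
noncomputable def solitonExponent (c : ι → ℂ) (φ ψ : ι → (Fin n → ℂ) → ℂ)
    (f g : Fin n → (Fin n → ℂ) → ℂ) (h k : (Fin n → ℂ) → ℂ) (lam : ℝ) (z w : Fin n → ℂ) : ℂ :=
  -(lam / 2 : ℂ) * polarized c φ ψ z w -
    ∑ j, (f j z * polarized c (fun i => holoPartial j (φ i)) ψ z w +
      g j w * polarized c φ (fun i => holoPartial j (ψ i)) z w) + h z + k w

/-- The polarization of `det (∂²D / ∂z_a ∂z̄_b)`. -/
noncomputable def hessianDet (c : ι → ℂ) (φ ψ : ι → (Fin n → ℂ) → ℂ) (z w : Fin n → ℂ) : ℂ :=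
  Matrix.det (Matrix.of fun a b : Fin n =>
    polarized c (fun i => holoPartial a (φ i)) (fun i => holoPartial b (ψ i)) z w)

variable {c : ι → ℂ} {φ ψ : ι → (Fin n → ℂ) → ℂ} {f g : Fin n → (Fin n → ℂ) → ℂ}
  {h k : (Fin n → ℂ) → ℂ}

theorem solitonExponent_mem_separatedHolomorphic {U W : Set (Fin n → ℂ)}
    (hφ : ∀ i, DifferentiableOn ℂ (φ i) U) (hψ : ∀ i, DifferentiableOn ℂ (ψ i) W)
    (hdφ : ∀ i a, DifferentiableOn ℂ (holoPartial a (φ i)) U)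
    (hdψ : ∀ i a, DifferentiableOn ℂ (holoPartial a (ψ i)) W)
    (hf : ∀ j, DifferentiableOn ℂ (f j) U) (hg : ∀ j, DifferentiableOn ℂ (g j) W)
    (hh : DifferentiableOn ℂ h U) (hk : DifferentiableOn ℂ k W) (lam : ℝ) :
    solitonExponent c φ ψ f g h k lam ∈ separatedHolomorphic U W := by
  have : solitonExponent c φ ψ f g h k lam =
      algebraMap ℂ _ (-(lam / 2 : ℂ)) * polarized c φ ψ -
        ∑ j, ((fun z _ => f j z) * polarized c (fun i => holoPartial j (φ i)) ψ +
          (fun _ w => g j w) * polarized c φ (fun i => holoPartial j (ψ i))) +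
        (fun z _ => h z) + fun _ w => k w := by
    ext z w
    simp [solitonExponent]
  rw [this]
  refine add_mem (add_mem (sub_mem (mul_mem (Subalgebra.algebraMap_mem _ _)
    (polarized_mem_separatedHolomorphic c hφ hψ)) (sum_mem fun j _ => add_mem ?_ ?_))
    (separatedHolomorphic_of_left hh)) (separatedHolomorphic_of_right hk)
  · exact mul_mem (separatedHolomorphic_of_left (hf j))
      (polarized_mem_separatedHolomorphic c (fun i => hdφ i j) hψ)
  · exact mul_mem (separatedHolomorphic_of_right (hg j))
      (polarized_mem_separatedHolomorphic c hφ fun i => hdψ i j)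

theorem hessianDet_mem_separatedHolomorphic {U W : Set (Fin n → ℂ)}
    (hdφ : ∀ i a, DifferentiableOn ℂ (holoPartial a (φ i)) U)
    (hdψ : ∀ i a, DifferentiableOn ℂ (holoPartial a (ψ i)) W) :
    hessianDet c φ ψ ∈ separatedHolomorphic U W := by
  have : hessianDet c φ ψ = ∑ σ : Equiv.Perm (Fin n), Equiv.Perm.sign σ • ∏ b,
      polarized c (fun i => holoPartial (σ b) (φ i)) (fun i => holoPartial b (ψ i)) := by
    ext z w
    simp [hessianDet, Matrix.det_apply]
  rw [this]
  refine sum_mem fun σ _ => ?_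
  rw [Units.smul_def]
  exact zsmul_mem (prod_mem fun b _ =>
    polarized_mem_separatedHolomorphic c (fun i => hdφ i _) fun i => hdψ i _) _

/-- If the polarized soliton equation holds and the polarized potential `∑ c i * φ i z * ψ i w`
has Bochner's normalized first derivatives along `z = p` and `w = q`, then the exponent is
constant near `(p, q)`. -/
theorem exists_forall_solitonExponent_eq {p q : Fin n → ℂ} {ε : ℝ} (hε : 0 < ε)
    (hφ : ∀ i, DifferentiableOn ℂ (φ i) (ball p ε)) (hψ : ∀ i, DifferentiableOn ℂ (ψ i) (ball q ε))
    (hdφ : ∀ i a, DifferentiableOn ℂ (holoPartial a (φ i)) (ball p ε))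
    (hdψ : ∀ i a, DifferentiableOn ℂ (holoPartial a (ψ i)) (ball q ε))
    (hf : ∀ j, DifferentiableOn ℂ (f j) (ball p ε)) (hg : ∀ j, DifferentiableOn ℂ (g j) (ball q ε))
    (hh : DifferentiableOn ℂ h (ball p ε)) (hk : DifferentiableOn ℂ k (ball q ε)) (lam : ℝ)
    (hexp : ∀ z ∈ ball p ε, ∀ w ∈ ball q ε,
      exp (solitonExponent c φ ψ f g h k lam z w) = hessianDet c φ ψ z w)
    (hp : ∀ w ∈ ball q ε, ∀ a, polarized c (fun i => holoPartial a (φ i)) ψ p w = w a - q a)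
    (hq : ∀ z ∈ ball p ε, ∀ b, polarized c φ (fun i => holoPartial b (ψ i)) z q = z b - p b) :
    ∃ δ > 0, ∀ z ∈ ball p δ, ∀ w ∈ ball q δ, solitonExponent c φ ψ f g h k lam z w =
      solitonExponent c φ ψ f g h k lam p q := by
  have hF : ∀ {r}, r ≤ ε → solitonExponent c φ ψ f g h k lam ∈
      separatedHolomorphic (ball p r) (ball q r) := fun hr => by
    have h1 := Metric.ball_subset_ball (x := p) hr
    have h2 := Metric.ball_subset_ball (x := q) hr
    exact solitonExponent_mem_separatedHolomorphic (fun i => (hφ i).mono h1)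
      (fun i => (hψ i).mono h2) (fun i a => (hdφ i a).mono h1) (fun i a => (hdψ i a).mono h2)
      (fun j => (hf j).mono h1) (fun j => (hg j).mono h2) (hh.mono h1) (hk.mono h2) lam
  have hG : ∀ {r}, r ≤ ε → hessianDet c φ ψ ∈ separatedHolomorphic (ball p r) (ball q r) :=
    fun hr => hessianDet_mem_separatedHolomorphic
      (fun i a => (hdφ i a).mono (Metric.ball_subset_ball hr))
      (fun i a => (hdψ i a).mono (Metric.ball_subset_ball hr))
  have hp0 : p ∈ ball p ε := Metric.mem_ball_self hε
  have hq0 : q ∈ ball q ε := Metric.mem_ball_self hε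
  have hGp : ∀ w ∈ ball q ε, hessianDet c φ ψ p w = 1 := by
    intro w hw
    have : Matrix.of (fun a b : Fin n =>
        polarized c (fun i => holoPartial a (φ i)) (fun i => holoPartial b (ψ i)) p w) = 1 := by
      ext a b
      have := sum_holoPartial_mul_eq_of_eventuallyEq (p := w)
        (fun i => (hψ i).differentiableAt (Metric.isOpen_ball.mem_nhds hw))
        (fun i => c i * holoPartial a (φ i) p) a (q a) (by
          filter_upwards [Metric.isOpen_ball.mem_nhds hw] with x hx
          rw [← hp x hx a]
          exact Finset.sum_congr rfl fun i _ => by ring) b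
      rw [Matrix.of_apply, Matrix.one_apply, ← this]
      exact Finset.sum_congr rfl fun i _ => by ring
    rw [hessianDet, this, Matrix.det_one]
  have hGq : ∀ z ∈ ball p ε, hessianDet c φ ψ z q = 1 := by
    intro z hz
    have : Matrix.of (fun a b : Fin n =>
        polarized c (fun i => holoPartial a (φ i)) (fun i => holoPartial b (ψ i)) z q) = 1 := by
      ext a b
      have := sum_holoPartial_mul_eq_of_eventuallyEq (p := z)
        (fun i => (hφ i).differentiableAt (Metric.isOpen_ball.mem_nhds hz))
        (fun i => c i * holoPartial b (ψ i) q) b (p b) (by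
          filter_upwards [Metric.isOpen_ball.mem_nhds hz] with x hx
          rw [← hq x hx b]
          exact Finset.sum_congr rfl fun i _ => by ring) a
      simp_rw [Matrix.of_apply, Matrix.one_apply, eq_comm (a := a), ← this]
      exact Finset.sum_congr rfl fun i _ => by ring
    rw [hessianDet, this, Matrix.det_one]
  have hFc : ContinuousAt (fun x : (Fin n → ℂ) × (Fin n → ℂ) =>
      solitonExponent c φ ψ f g h k lam x.1 x.2) (p, q) :=
    ((differentiableOn_of_mem_separatedHolomorphic (hF le_rfl)).differentiableAt
      (prod_mem_nhds (Metric.ball_mem_nhds p hε) (Metric.ball_mem_nhds q hε))).continuousAt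
  have hFp := eventually_eq_of_eventually_exp_eq_one (x := q)
    (hFc.comp (f := fun w => (p, w)) (by fun_prop))
    (by
      filter_upwards [Metric.ball_mem_nhds q hε] with w hw
      exact (hexp p hp0 w hw).trans (hGp w hw))
  have hFq := eventually_eq_of_eventually_exp_eq_one (x := p)
    (hFc.comp (f := fun z => (z, q)) (by fun_prop))
    (by
      filter_upwards [Metric.ball_mem_nhds p hε] with z hz
      exact (hexp z hz q hq0).trans (hGq z hz))
  obtain ⟨δ₁, h1, hδ₁⟩ := Metric.eventually_nhds_iff_ball.mp hFp
  obtain ⟨δ₂, h2, hδ₂⟩ := Metric.eventually_nhds_iff_ball.mp hFq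
  refine ⟨min ε (min δ₁ δ₂), lt_min hε (lt_min h1 h2), ?_⟩
  exact eq_const_of_exp_eq_of_separatedHolomorphic (hF (min_le_left _ _)) (hG (min_le_left _ _))
    (fun z hz w hw => hexp z (Metric.ball_subset_ball (min_le_left _ _) hz) w
      (Metric.ball_subset_ball (min_le_left _ _) hw))
    (fun z hz => hδ₂ z (Metric.ball_subset_ball
      ((min_le_right _ _).trans (min_le_right _ _)) hz))
    (fun w hw => hδ₁ w (Metric.ball_subset_ball
      ((min_le_right _ _).trans (min_le_left _ _)) hw))

end Soliton

theorem wderiv_congr_of_eventuallyEq {n : ℕ} {F G : (Fin n → ℂ) → ℂ} {z : Fin n → ℂ}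
    (h : F =ᶠ[𝓝 z] G) (a : Fin n) : wderiv a F z = wderiv a G z := by
  rw [wderiv, wderiv, h.fderiv_eq]

theorem differentiableOn_star_star {n : ℕ} {u : (Fin n → ℂ) → ℂ} {p : Fin n → ℂ} {ε : ℝ}
    (hu : DifferentiableOn ℂ u (ball p ε)) :
    DifferentiableOn ℂ (star ∘ u ∘ star) (ball (star p) ε) := by
  intro w hw
  have hw' : star w ∈ ball p ε := by
    rw [mem_ball_iff_norm] at hw ⊢
    rwa [← norm_star, star_sub, star_star]
  have := (hu.differentiableAt (Metric.isOpen_ball.mem_nhds hw')).star_star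
  rw [star_star] at this
  exact this.differentiableWithinAt

/-- Local form of the main theorem, flat case: a Kähler–Ricci soliton induced by a
Kähler immersion into flat (possibly indefinite) `ℂ^N` is Ricci flat: the soliton
potential `−(λ/2)D − f_X + h + h̄` is constant, hence so is `det[∂²D/∂z_a ∂z̄_b]`. -/
theorem stmt8 {n N : ℕ} (p : Fin n → ℂ) (s : ℕ) (hs : s ≤ N)
    (φ : Fin N → (Fin n → ℂ) → ℂ)
    (hφ : ∀ i, AnalyticAt ℂ (φ i) p) (hφ0 : ∀ i, φ i p = 0)
    (D : (Fin n → ℂ) → ℂ)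
    (hD : ∀ z, D z = ∑ i : Fin N, (if (i : ℕ) < s then (1 : ℂ) else -1) *
      (φ i z * (starRingEnd ℂ) (φ i z)))
    (hBochner : IsBochnerAt D p)
    (lam : ℝ) (fvec : Fin n → (Fin n → ℂ) → ℂ) (h : (Fin n → ℂ) → ℂ)
    (hfvec : ∀ j, AnalyticAt ℂ (fvec j) p) (hh : AnalyticAt ℂ h p)
    (fX : (Fin n → ℂ) → ℂ)
    (hfX : ∀ z, fX z = ∑ j : Fin n,
      (fvec j z * wderiv j D z + (starRingEnd ℂ) (fvec j z) * wderivBar j D z))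
    (hsoliton : ∀ᶠ z in 𝓝 p,
      Matrix.det (Matrix.of fun a b : Fin n => wderiv a (wderivBar b D) z) =
        Complex.exp (-(lam / 2 : ℂ) * D z - fX z + h z + (starRingEnd ℂ) (h z))) :
    ∃ C : ℂ,
      (∀ᶠ z in 𝓝 p,
        -(lam / 2 : ℂ) * D z - fX z + h z + (starRingEnd ℂ) (h z) = C) ∧
      (∀ᶠ z in 𝓝 p,
        Matrix.det (Matrix.of fun a b : Fin n => wderiv a (wderivBar b D) z) =
          Complex.exp C) := by
  set c : Fin N → ℂ := fun i => if (i : ℕ) < s then (1 : ℂ) else -1 with hc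
  set ψ : Fin N → (Fin n → ℂ) → ℂ := fun i => star ∘ φ i ∘ star with hψ
  have hDeq : D = fun z => polarized c φ ψ z (star z) := by
    ext z
    simp [hD, polarized, hψ, hc]
  obtain ⟨E, U, V, hU, hV, hpU, hpV, hE, hDE, hR1, hR2⟩ := hBochner
  obtain ⟨ε₁, hε₁, hball₁⟩ := Metric.eventually_nhds_iff_ball.mp
    ((eventually_all.mpr fun i => (hφ i).eventually_analyticAt).and
      ((eventually_all.mpr fun j => (hfvec j).eventually_analyticAt).and
        (hh.eventually_analyticAt.and ((hU.eventually_mem hpU).and (hDE.and hsoliton)))))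
  obtain ⟨ε₂, hε₂, hball₂⟩ := Metric.eventually_nhds_iff_ball.mp
    (hV.eventually_mem hpV)
  obtain ⟨ε, hε, hle₁, hle₂⟩ : ∃ ε > 0, ε ≤ ε₁ ∧ ε ≤ ε₂ :=
    ⟨min ε₁ ε₂, lt_min hε₁ hε₂, min_le_left _ _, min_le_right _ _⟩
  have hball := fun z (hz : z ∈ ball p ε) => hball₁ z (Metric.ball_subset_ball hle₁ hz)
  have hballV := fun w (hw : w ∈ ball (star p) ε) => hball₂ w (Metric.ball_subset_ball hle₂ hw)
  clear hball₁ hball₂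
  have hφd : ∀ i, DifferentiableOn ℂ (φ i) (ball p ε) := fun i z hz =>
    ((hball z hz).1 i).differentiableAt.differentiableWithinAt
  have hdφd : ∀ i a, DifferentiableOn ℂ (holoPartial a (φ i)) (ball p ε) := fun i a z hz =>
    (((hball z hz).1 i).holoPartial a).differentiableAt.differentiableWithinAt
  have hfd : ∀ j, DifferentiableOn ℂ (fvec j) (ball p ε) := fun j z hz =>
    ((hball z hz).2.1 j).differentiableAt.differentiableWithinAt
  have hhd : DifferentiableOn ℂ h (ball p ε) := fun z hz =>
    (hball z hz).2.2.1.differentiableAt.differentiableWithinAt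
  have hψd : ∀ i, DifferentiableOn ℂ (ψ i) (ball (star p) ε) := fun i =>
    differentiableOn_star_star (hφd i)
  have hφat : ∀ z ∈ ball p ε, ∀ i, DifferentiableAt ℂ (φ i) z := fun z hz i =>
    ((hball z hz).1 i).differentiableAt
  have hstar : ∀ {r : ℝ} {w : Fin n → ℂ}, w ∈ ball (star p) r → star w ∈ ball p r := by
    intro r w hw
    rw [mem_ball_iff_norm] at hw ⊢
    rwa [← norm_star, star_sub, star_star]
  have hstar' : ∀ {r : ℝ} {z : Fin n → ℂ}, z ∈ ball p r → star z ∈ ball (star p) r := by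
    intro r z hz
    rw [mem_ball_iff_norm] at hz ⊢
    rwa [← star_sub, norm_star]
  have hdψeq : ∀ i a, ∀ w ∈ ball (star p) ε,
      holoPartial a (ψ i) w = (star ∘ holoPartial a (φ i) ∘ star) w := fun i a w hw =>
    holoPartial_star_star (hφat _ (hstar hw) i) a
  have hdψd : ∀ i a, DifferentiableOn ℂ (holoPartial a (ψ i)) (ball (star p) ε) := fun i a =>
    (differentiableOn_star_star (hdφd i a)).congr (hdψeq i a)
  have hwderiv : ∀ z ∈ ball p ε, ∀ j, wderiv j D z =
      polarized c (fun i => holoPartial j (φ i)) ψ z (star z) := fun z hz j => by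
    rw [hDeq]
    exact wderiv_polarized_star (hφat z hz) (hφat z hz) j
  have hwderivBar : ∀ z ∈ ball p ε, ∀ j, wderivBar j D z =
      polarized c φ (fun i => star ∘ holoPartial j (φ i) ∘ star) z (star z) := fun z hz j => by
    rw [hDeq]
    exact wderivBar_polarized_star (hφat z hz) (hφat z hz) j
  have hdψpol : ∀ z ∈ ball p ε, ∀ j (u : Fin N → (Fin n → ℂ) → ℂ),
      polarized c u (fun i => star ∘ holoPartial j (φ i) ∘ star) z (star z) =
        polarized c u (fun i => holoPartial j (ψ i)) z (star z) := fun z hz j u =>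
    Finset.sum_congr rfl fun i _ => by simp only [hdψeq i j _ (hstar' hz)]
  have hHess : ∀ z ∈ ball p ε, Matrix.det (Matrix.of fun a b : Fin n =>
      wderiv a (wderivBar b D) z) = hessianDet c φ ψ z (star z) := by
    intro z hz
    rw [hessianDet]
    congr 2
    ext a b
    have h1 : wderivBar b D =ᶠ[𝓝 z] fun z =>
        polarized c φ (fun i => star ∘ holoPartial b (φ i) ∘ star) z (star z) := by
      filter_upwards [Metric.isOpen_ball.mem_nhds hz] with x hx using hwderivBar x hx b
    rw [wderiv_congr_of_eventuallyEq h1, ← hdψpol z hz]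
    exact wderiv_polarized_star (hφat z hz)
      (fun i => ((hdφd i b).differentiableAt (Metric.isOpen_ball.mem_nhds hz))) a
  set g : Fin n → (Fin n → ℂ) → ℂ := fun j => star ∘ fvec j ∘ star with hg
  set k : (Fin n → ℂ) → ℂ := star ∘ h ∘ star with hk
  have hexponent : ∀ z ∈ ball p ε, -(lam / 2 : ℂ) * D z - fX z + h z + (starRingEnd ℂ) (h z) =
      solitonExponent c φ ψ fvec g h k lam z (star z) := by
    intro z hz
    simp only [hfX, hwderiv z hz, hwderivBar z hz, hdψpol z hz]
    simp [hDeq, solitonExponent, hg, hk]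
  have hgd : ∀ j, DifferentiableOn ℂ (g j) (ball (star p) ε) := fun j =>
    differentiableOn_star_star (hfd j)
  have hkd : DifferentiableOn ℂ k (ball (star p) ε) := differentiableOn_star_star hhd
  have hEpol : ∀ z ∈ ball p (ε / 4), ∀ w ∈ ball (star p) (ε / 4),
      E z w = polarized c φ ψ z w := by
    intro z hz w hw
    refine sub_eq_zero.mp (eq_zero_of_forall_star_eq_zero (p := p) (ε := ε)
      (H := fun z w => E z w - polarized c φ ψ z w) ?_ (fun z hz => ?_) z hz w hw)
    · exact (hE.mono fun x hx => ⟨(hball _ hx.1).2.2.2.1, hballV _ hx.2⟩).sub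
        (differentiableOn_of_mem_separatedHolomorphic
          (polarized_mem_separatedHolomorphic c hφd hψd))
    · rw [sub_eq_zero, ← (hball z hz).2.2.2.2.1, hDeq]
  have hexp : ∀ z ∈ ball p (ε / 4), ∀ w ∈ ball (star p) (ε / 4),
      exp (solitonExponent c φ ψ fvec g h k lam z w) = hessianDet c φ ψ z w := by
    intro z hz w hw
    refine sub_eq_zero.mp (eq_zero_of_forall_star_eq_zero (p := p) (ε := ε)
      (H := fun z w => exp (solitonExponent c φ ψ fvec g h k lam z w) - hessianDet c φ ψ z w)
      ?_ (fun z hz => ?_) z hz w hw)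
    · exact (differentiableOn_of_mem_separatedHolomorphic
        (solitonExponent_mem_separatedHolomorphic hφd hψd hdφd hdψd hfd hgd hhd hkd lam)).cexp.sub
        (differentiableOn_of_mem_separatedHolomorphic
          (hessianDet_mem_separatedHolomorphic hdφd hdψd))
    · rw [sub_eq_zero, ← hexponent z hz, ← hHess z hz]
      exact (hball z hz).2.2.2.2.2.symm
  have hε4 : 0 < ε / 4 := by positivity
  have hb : ∀ {x : Fin n → ℂ}, ball x (ε / 4) ⊆ ball x ε := fun {x} =>
    Metric.ball_subset_ball (by linarith)
  obtain ⟨δ, hδ, hconst⟩ := exists_forall_solitonExponent_eq (p := p) (q := star p) hε4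
    (fun i => (hφd i).mono hb) (fun i => (hψd i).mono hb) (fun i a => (hdφd i a).mono hb)
    (fun i a => (hdψd i a).mono hb) (fun j => (hfd j).mono hb) (fun j => (hgd j).mono hb)
    (hhd.mono hb) (hkd.mono hb) lam hexp
    (fun w hw a => by
      have := sum_holoPartial_mul_eq_of_fderiv_eq_zero
        (hφat p (Metric.mem_ball_self hε)) (fun i => c i * ψ i w)
        (fun j => w j - (starRingEnd ℂ) (p j)) (by
          filter_upwards [Metric.ball_mem_nhds p hε4] with z hz
          rw [hEpol z hz w hw, polarized]
          simp only [mul_left_comm]) (hR1 w (hballV w (hb hw))).2 a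
      refine Eq.trans ?_ this
      simp only [polarized, mul_left_comm])
    (fun z hz b => by
      have := sum_holoPartial_mul_eq_of_fderiv_eq_zero (p := star p)
        (fun i => (hψd i).differentiableAt (Metric.ball_mem_nhds _ hε)) (fun i => c i * φ i z)
        (fun j => z j - p j) (by
          filter_upwards [Metric.ball_mem_nhds (star p) hε4] with w hw
          rw [hEpol z hz w hw, polarized]
          congr 1
          · exact Finset.sum_congr rfl fun i _ => by ring
          · exact Finset.sum_congr rfl fun i _ => mul_comm _ _)
          (hR2 z (hball z (hb hz)).2.2.2.1).2 b
      rw [← this, polarized]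
      exact Finset.sum_congr rfl fun i _ => by ring)
  have hfinal : ∀ᶠ z in 𝓝 p, -(lam / 2 : ℂ) * D z - fX z + h z + (starRingEnd ℂ) (h z) =
      solitonExponent c φ ψ fvec g h k lam p (star p) := by
    filter_upwards [Metric.ball_mem_nhds p hε, Metric.ball_mem_nhds p hδ] with z hz hzδ
    rw [hexponent z hz, hconst z hzδ _ (hstar' hzδ)]
  refine ⟨_, hfinal, ?_⟩
  filter_upwards [hfinal, hsoliton] with z h1 h2
  rw [h2, h1]
end

section
/- Let p ∈ ℂ^n, let a ∈ ℝ and let α be a tuple of holomorphic functions on a neighborhood of p vanishing at p such that f := a + ⟨α,α⟩_ℓ is positive on a neighborhood of p, and let μ ∈ ℝ. Suppose there exist reals b, c and tuples β, γ of holomorphic functions vanishing at p, with c + ⟨γ,γ⟩_r nonvanishing at p, such that f(z)^μ = (b + ⟨β(z),β(z)⟩_q)/(c + ⟨γ(z),γ(z)⟩_r) on a neighborhood of p, and suppose f^μ is not constant on any neighborhood of p. Then μ is a rational number. -/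
open Filter Topology Complex

/-- `⟨α,α⟩_ℓ(z) = Σ_{j<ℓ} |α_j(z)|² − Σ_{j≥ℓ} |α_j(z)|²` (0-indexed), real valued. -/
noncomputable def hermR {n m : ℕ} (ℓ : ℕ) (α : Fin m → (Fin n → ℂ) → ℂ)
    (z : Fin n → ℂ) : ℝ :=
  ∑ j : Fin m, (if (j : ℕ) < ℓ then (1 : ℝ) else -1) * Complex.normSq (α j z)

namespace PowerSeries

lemma X_mul_derivative_X_pow_mul {R : Type*} [CommRing R] (n : ℕ) (P : R⟦X⟧) :
    X * d⁄dX R (X ^ n * P) = X ^ n * ((n : R⟦X⟧) * P + X * d⁄dX R P) := by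
  rw [Derivation.leibniz, derivative_pow, derivative_X]
  rcases n with _ | n
  · simp
  · simp only [smul_eq_mul, Nat.add_sub_cancel]
    ring

/-- If a multiple of the logarithmic derivative of a series vanishing at the origin is a difference
of logarithmic derivatives, then the factor is rational. -/
lemma exists_rat_of_logDeriv_eq {k : Type*} [Field k] [CharZero k] {m : k} {F G H : k⟦X⟧}
    (hF : F ≠ 0) (hG : G ≠ 0) (hH : H ≠ 0) (hF0 : constantCoeff F = 0)
    (h : C m * d⁄dX k F * G * H = F * (d⁄dX k G * H - G * d⁄dX k H)) :
    ∃ q : ℚ, m = q := by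
  obtain ⟨f, P, hP, rfl⟩ : ∃ f : ℕ, ∃ P : k⟦X⟧, constantCoeff P ≠ 0 ∧ F = X ^ f * P :=
    ⟨_, _, by simpa [constantCoeff_divXPowOrder_eq_zero_iff] using hF,
      X_pow_order_mul_divXPowOrder.symm⟩
  obtain ⟨g, Q, hQ, rfl⟩ : ∃ f : ℕ, ∃ P : k⟦X⟧, constantCoeff P ≠ 0 ∧ G = X ^ f * P :=
    ⟨_, _, by simpa [constantCoeff_divXPowOrder_eq_zero_iff] using hG,
      X_pow_order_mul_divXPowOrder.symm⟩
  obtain ⟨l, R, hR, rfl⟩ : ∃ f : ℕ, ∃ P : k⟦X⟧, constantCoeff P ≠ 0 ∧ H = X ^ f * P :=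
    ⟨_, _, by simpa [constantCoeff_divXPowOrder_eq_zero_iff] using hH,
      X_pow_order_mul_divXPowOrder.symm⟩
  have hf : (f : k) ≠ 0 := by
    rintro h0
    obtain rfl : f = 0 := by exact_mod_cast h0
    simp at hF0
    exact hP hF0
  have key : C m * ((f : k⟦X⟧) * P + X * d⁄dX k P) * Q * R =
      P * (((g : k⟦X⟧) * Q + X * d⁄dX k Q) * R - Q * ((l : k⟦X⟧) * R + X * d⁄dX k R)) := by
    have hX : (X : k⟦X⟧) ^ (f + g + l) ≠ 0 := pow_ne_zero _ X_ne_zero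
    apply mul_left_cancel₀ hX
    have h1 := X_mul_derivative_X_pow_mul f P
    have h2 := X_mul_derivative_X_pow_mul g Q
    have h3 := X_mul_derivative_X_pow_mul l R
    linear_combination X * h - C m * X ^ g * Q * X ^ l * R * h1 +
      X ^ f * P * X ^ l * R * h2 - X ^ f * P * X ^ g * Q * h3
  have := congrArg constantCoeff key
  simp only [map_mul, map_add, map_sub, constantCoeff_C, map_natCast, constantCoeff_X,
    zero_mul, add_zero] at this
  refine ⟨((g : ℚ) - l) / f, ?_⟩
  push_cast
  rw [eq_div_iff hf]
  apply mul_right_cancel₀ (mul_ne_zero (mul_ne_zero hP hQ) hR)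
  linear_combination this

lemma derivative_map {R S : Type*} [CommRing R] [CommRing S] (f : R →+* S) (P : R⟦X⟧) :
    d⁄dX S (map f P) = map f (d⁄dX R P) := by
  ext i
  simp [coeff_derivative]

/-- A power series whose coefficients span a finite-dimensional space over a subfield contained in
a valuation ring is a scalar multiple of one with integral coefficients, not all of them in the
maximal ideal. -/
lemma exists_eq_C_mul_map_valuationSubring {k K : Type*} [Field k] [Field K] [Algebra k K]
    (V : ValuationSubring K) (hV : ∀ x : k, algebraMap k K x ∈ V) {F : K⟦X⟧} (hF : F ≠ 0)
    (hfin : (Submodule.span k (Set.range fun n => coeff n F)).FG) :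
    ∃ u : K, u ≠ 0 ∧ ∃ F₀ : V⟦X⟧, F = C u * map V.subtype F₀ ∧
      map (IsLocalRing.residue V) F₀ ≠ 0 := by
  obtain ⟨s, hs, hspan⟩ := Submodule.fg_span_iff_fg_span_finset_subset _ |>.1 hfin
  obtain ⟨n, hn⟩ := exists_coeff_ne_zero_iff_ne_zero.2 hF
  have hsne : s.Nonempty := by
    rw [Finset.nonempty_iff_ne_empty]
    rintro rfl
    have : coeff n F ∈ Submodule.span k (Set.range fun n => coeff n F) :=
      Submodule.subset_span ⟨n, rfl⟩
    rw [hspan] at this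
    simp at this
    exact hn this
  obtain ⟨u, hus, hu⟩ := s.exists_max_image V.valuation hsne
  have hle : ∀ j, V.valuation (coeff j F) ≤ V.valuation u := by
    intro j
    have : coeff j F ∈ Submodule.span k (Set.range fun n => coeff n F) :=
      Submodule.subset_span ⟨j, rfl⟩
    rw [hspan] at this
    generalize coeff j F = y at this
    induction this using Submodule.span_induction with
    | mem x hx => exact hu x hx
    | zero => simp
    | add x y _ _ hx hy => exact Valuation.map_add_le _ hx hy
    | smul c x _ hx =>
      rw [Algebra.smul_def, map_mul]
      exact (mul_le_of_le_one_left' ((V.valuation_le_one_iff _).2 (hV c))).trans hx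
  have hu0 : u ≠ 0 := by
    rintro rfl
    have := hle n
    simp at this
    exact hn this
  obtain ⟨j, hj⟩ := hs hus
  have hmem : ∀ i, u⁻¹ * coeff i F ∈ V := by
    intro i
    rw [← V.valuation_le_one_iff, map_mul, map_inv₀]
    exact inv_mul_le_one_of_le₀ (hle i) zero_le
  refine ⟨u, hu0, mk fun i => ⟨_, hmem i⟩, ?_, ?_⟩
  · ext i
    simp [hu0]
  · intro h0
    have := congrArg (coeff j) h0
    have h1 : (⟨u⁻¹ * coeff j F, hmem j⟩ : V) = 1 := by
      ext
      simp only at hj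
      simp [hj, hu0]
    simp [h1] at this

lemma exists_rat_of_logDeriv_eq_of_transcendental {k K : Type*} [Field k] [CharZero k] [Field K]
    [Algebra k K] {m a : k} {F G H : K⟦X⟧} (hF : F ≠ 0) (hG : G ≠ 0) (hH : H ≠ 0)
    (hFfin : (Submodule.span k (Set.range fun n => coeff n F)).FG)
    (hGfin : (Submodule.span k (Set.range fun n => coeff n G)).FG)
    (hHfin : (Submodule.span k (Set.range fun n => coeff n H)).FG)
    (hF0 : coeff 0 F = algebraMap k K a)
    (htr : ∃ n, ¬ IsIntegral k (coeff n F))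
    (h : C (algebraMap k K m) * d⁄dX K F * G * H = F * (d⁄dX K G * H - G * d⁄dX K H)) :
    ∃ q : ℚ, m = q := by
  obtain ⟨n, hn⟩ := htr
  obtain ⟨V, hV, hnV⟩ : ∃ V : ValuationSubring K, (∀ x : k, algebraMap k K x ∈ V) ∧
      coeff n F ∉ V := by
    by_contra! hcon
    have hmem : coeff n F ∈ (⨅ V : {V : ValuationSubring K //
        Set.range (algebraMap k K) ⊆ V.toSubring}, V.1.toSubring) := by
      rw [Subring.mem_iInf]
      exact fun V => hcon V.1 fun x => V.2 ⟨x, rfl⟩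
    rw [iInf_valuationSubring_superset] at hmem
    have hi : IsIntegral (Subring.closure (Set.range (algebraMap k K))) (coeff n F) := hmem
    have hcl : Subring.closure (Set.range (algebraMap k K)) =
        (⊥ : Subalgebra k K).toSubring := by
      rw [← RingHom.coe_range, Subring.closure_eq]
      ext
      simp [Algebra.mem_bot]
    rw [hcl] at hi
    exact hn (isIntegral_trans (A := (⊥ : Subalgebra k K)) _ hi)
  obtain ⟨u, hu, F₀, hFe, hFr⟩ := exists_eq_C_mul_map_valuationSubring V hV hF hFfin
  obtain ⟨v, hv, G₀, hGe, hGr⟩ := exists_eq_C_mul_map_valuationSubring V hV hG hGfin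
  obtain ⟨w, hw, H₀, hHe, hHr⟩ := exists_eq_C_mul_map_valuationSubring V hV hH hHfin
  let ι : k →+* V := (algebraMap k K).codRestrict V hV
  have key : C (ι m) * d⁄dX V F₀ * G₀ * H₀ = F₀ * (d⁄dX V G₀ * H₀ - G₀ * d⁄dX V H₀) := by
    apply map_injective V.subtype Subtype.val_injective
    have hne : C (u * v * w) ≠ (0 : K⟦X⟧) := by simp [hu, hv, hw]
    apply mul_left_cancel₀ hne
    rw [hFe, hGe, hHe] at h
    simp only [Derivation.leibniz, derivative_C, smul_eq_mul, mul_zero, add_zero, derivative_map] at h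
    have hι : V.subtype (ι m) = algebraMap k K m := rfl
    simp only [map_mul, map_sub, map_C, hι]
    linear_combination h
  have keyr := congrArg (map (IsLocalRing.residue V)) key
  simp only [map_mul, map_sub, map_C, ← derivative_map] at keyr
  have : CharZero (IsLocalRing.ResidueField V) :=
    charZero_of_injective_ringHom ((IsLocalRing.residue V).comp ι).injective
  have hr0 : constantCoeff (map (IsLocalRing.residue V) F₀) = 0 := by
    rw [← coeff_zero_eq_constantCoeff_apply, coeff_map, IsLocalRing.residue_eq_zero_iff,
      IsLocalRing.mem_maximalIdeal, mem_nonunits_iff]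
    intro hunit
    apply hnV
    obtain ⟨y, hy⟩ := hunit.exists_right_inv
    have hc : ∀ i, coeff i F = u * (coeff i F₀ : V) := by
      intro i
      conv_lhs => rw [hFe]
      simp
    have hy' : ((coeff 0 F₀ : V) : K) * y = 1 := congrArg Subtype.val hy
    have : coeff n F = ((ι a * y * coeff n F₀ : V) : K) := by
      rw [hc n]
      have h0 := hc 0
      have hι : ((ι a : V) : K) = algebraMap k K a := rfl
      rw [hF0] at h0
      push_cast
      rw [hι, h0]
      linear_combination - u * (coeff n F₀ : V) * hy'
    rw [this]
    exact Subtype.prop _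
  obtain ⟨q, hq⟩ := exists_rat_of_logDeriv_eq hFr hGr hHr hr0 keyr
  exact ⟨q, ((IsLocalRing.residue V).comp ι).injective (by rw [map_ratCast]; exact hq)⟩

end PowerSeries

/-- The algebra of functions of one complex variable that are analytic at the origin. -/
def analyticAtZero : Subalgebra ℂ (ℂ → ℂ) where
  carrier := {f | AnalyticAt ℂ f 0}
  mul_mem' hf hg := AnalyticAt.mul hf hg
  add_mem' hf hg := AnalyticAt.add hf hg
  algebraMap_mem' _ := analyticAt_const

namespace analyticAtZero

/-- Evaluation of an analytic germ representative at a point. -/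
def evalHom (z : ℂ) : analyticAtZero →+* ℂ :=
  (Pi.evalRingHom (fun _ : ℂ => ℂ) z).comp analyticAtZero.subtype

lemma evalHom_apply (z : ℂ) (f : analyticAtZero) : evalHom z f = (f : ℂ → ℂ) z := rfl

/-- The Taylor series at the origin. -/
noncomputable def taylor : analyticAtZero →ₐ[ℂ] PowerSeries ℂ where
  toFun f := PowerSeries.mk fun n => iteratedDeriv n (f : ℂ → ℂ) 0 / n.factorial
  map_one' := by
    ext n
    have : iteratedDeriv n (1 : ℂ → ℂ) 0 = if n = 0 then 1 else 0 := iteratedDeriv_const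
    simp only [OneMemClass.coe_one, PowerSeries.coeff_mk, this, PowerSeries.coeff_one]
    split_ifs with h <;> simp [h]
  map_zero' := by
    ext n
    simp
  map_add' f g := by
    ext n
    simp only [AddMemClass.coe_add, PowerSeries.coeff_mk, map_add]
    rw [iteratedDeriv_add f.2.contDiffAt g.2.contDiffAt, add_div]
  map_mul' f g := by
    ext n
    simp only [MulMemClass.coe_mul, PowerSeries.coeff_mk, PowerSeries.coeff_mul]
    rw [iteratedDeriv_mul f.2.contDiffAt g.2.contDiffAt,
      Finset.Nat.sum_antidiagonal_eq_sum_range_succ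
        (fun i j => iteratedDeriv i (f : ℂ → ℂ) 0 / i.factorial *
          (iteratedDeriv j (g : ℂ → ℂ) 0 / j.factorial)), Finset.sum_div]
    refine Finset.sum_congr rfl fun i hi => ?_
    rw [Nat.cast_choose ℂ (Finset.mem_range_succ_iff.1 hi)]
    have h1 : (n.factorial : ℂ) ≠ 0 := mod_cast n.factorial_ne_zero
    have h2 : (i.factorial : ℂ) ≠ 0 := mod_cast i.factorial_ne_zero
    have h3 : ((n - i).factorial : ℂ) ≠ 0 := mod_cast (n - i).factorial_ne_zero
    field_simp
  commutes' c := by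
    ext n
    have : iteratedDeriv n ((algebraMap ℂ (ℂ → ℂ)) c) 0 = if n = 0 then c else 0 :=
      iteratedDeriv_const
    simp only [SubalgebraClass.coe_algebraMap, PowerSeries.coeff_mk, this,
      PowerSeries.algebraMap_apply, Algebra.algebraMap_self, RingHom.id_apply, PowerSeries.coeff_C]
    split_ifs with h <;> simp [h]

lemma coeff_taylor (f : analyticAtZero) (n : ℕ) :
    PowerSeries.coeff n (taylor f) = iteratedDeriv n (f : ℂ → ℂ) 0 / n.factorial :=
  PowerSeries.coeff_mk n fun n => iteratedDeriv n (f : ℂ → ℂ) 0 / n.factorial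

lemma coeff_zero_taylor (f : analyticAtZero) :
    PowerSeries.coeff 0 (taylor f) = (f : ℂ → ℂ) 0 := by
  simp [coeff_taylor]

lemma taylor_eq_zero_iff (f : analyticAtZero) :
    taylor f = 0 ↔ (f : ℂ → ℂ) =ᶠ[𝓝 0] 0 := by
  constructor
  · intro h
    have h1 := f.2.hasFPowerSeriesAt
    have h2 : (fun n ↦ iteratedDeriv n (f : ℂ → ℂ) 0 / n.factorial) = 0 := by
      ext n
      rw [← coeff_taylor, h]
      simp
    rw [h2, (FormalMultilinearSeries.ofScalars_series_eq_zero ℂ).2 rfl] at h1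
    exact h1.eventually_eq_zero
  · intro h
    ext n
    rw [coeff_taylor, (h.iteratedDeriv n).eq_of_nhds]
    simp

/-- The derivative of a function analytic at the origin. -/
noncomputable def derivative (f : analyticAtZero) : analyticAtZero :=
  ⟨deriv f, f.2.deriv⟩

lemma taylor_derivative (f : analyticAtZero) :
    taylor (derivative f) = PowerSeries.derivative ℂ (taylor f) := by
  ext n
  rw [PowerSeries.coeff_derivative, coeff_taylor, coeff_taylor, Nat.factorial_succ,
    iteratedDeriv_succ']
  have h1 : (n.factorial : ℂ) ≠ 0 := mod_cast n.factorial_ne_zero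
  have h2 : (n : ℂ) + 1 ≠ 0 := mod_cast n.succ_ne_zero
  push_cast
  simp only [derivative]
  field_simp

end analyticAtZero

/-- A function analytic on a ball around `0 : ℂ` and zero at its real points is zero. -/
lemma eqOn_zero_of_forall_real {g : ℂ → ℂ} {ρ : ℝ} (hρ : 0 < ρ)
    (hg : AnalyticOnNhd ℂ g (Metric.ball 0 ρ)) (h : ∀ t : ℝ, |t| < ρ → g t = 0) :
    ∀ y : ℂ, ‖y‖ < ρ → g y = 0 := by
  have := hg.eqOn_zero_of_preconnected_of_frequently_eq_zero
    (convex_ball (0 : ℂ) ρ).isPreconnected (Metric.mem_ball_self hρ) (z₀ := 0) ?_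
  · exact fun y hy => this (by simpa using hy)
  · have ht : Tendsto (fun t : ℝ => (t : ℂ)) (𝓝[≠] 0) (𝓝[≠] 0) := by
      refine tendsto_nhdsWithin_iff.2 ⟨?_, ?_⟩
      · exact (continuous_ofReal.tendsto' 0 0 (by simp)).mono_left nhdsWithin_le_nhds
      · filter_upwards [self_mem_nhdsWithin] with t ht
        simpa using ht
    refine ht.frequently (Eventually.frequently ?_)
    have : ∀ᶠ t : ℝ in 𝓝 0, |t| < ρ := by
      filter_upwards [Metric.ball_mem_nhds (0 : ℝ) hρ] with t ht
      simpa using ht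
    filter_upwards [nhdsWithin_le_nhds this] with t ht using h t ht

/-- Polarization: an analytic function of two variables vanishing on the conjugate diagonal
vanishes. -/
lemma eventually_eq_zero_of_conj_diagonal {Φ : ℂ × ℂ → ℂ} (hΦ : AnalyticAt ℂ Φ 0)
    (h : ∀ᶠ z in 𝓝 (0 : ℂ), Φ (z, starRingEnd ℂ z) = 0) : ∀ᶠ x in 𝓝 (0 : ℂ × ℂ), Φ x = 0 := by
  obtain ⟨r, hr, hball⟩ := Metric.eventually_nhds_iff.1 hΦ.eventually_analyticAt
  obtain ⟨s, hs, hdiag⟩ := Metric.eventually_nhds_iff.1 h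
  set ρ := min r s / 2 with hρdef
  have hρ : 0 < ρ := by positivity
  have hbound : ∀ x y : ℂ, ‖x‖ < ρ → ‖y‖ < ρ → ‖x + y * I‖ < min r s ∧
      ‖x - y * I‖ < min r s := by
    intro x y hx hy
    have h1 := norm_add_le x (y * I)
    have h2 := norm_sub_le x (y * I)
    simp only [norm_mul, norm_I, mul_one] at h1 h2
    constructor <;> linarith
  have han : ∀ x y : ℂ, ‖x‖ < ρ → ‖y‖ < ρ → AnalyticAt ℂ Φ (x + y * I, x - y * I) := by
    intro x y hx hy
    apply hball
    rw [dist_zero_right, Prod.norm_def]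
    obtain ⟨h1, h2⟩ := hbound x y hx hy
    exact max_lt (h1.trans_le (min_le_left _ _)) (h2.trans_le (min_le_left _ _))
  have hreal : ∀ x y : ℝ, |x| < ρ → |y| < ρ → Φ ((x : ℂ) + y * I, (x : ℂ) - y * I) = 0 := by
    intro x y hx hy
    have := @hdiag (x + y * I) (by
      rw [dist_zero_right]
      exact (hbound x y (by simpa using hx) (by simpa using hy)).1.trans_le (min_le_right _ _))
    convert this using 3
    simp [sub_eq_add_neg]
  have hhalf : ∀ x : ℝ, |x| < ρ → ∀ y : ℂ, ‖y‖ < ρ → Φ ((x : ℂ) + y * I, (x : ℂ) - y * I) = 0 := by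
    intro x hx
    refine eqOn_zero_of_forall_real hρ (g := fun y => Φ ((x : ℂ) + y * I, (x : ℂ) - y * I))
      (fun y hy => ?_) (fun t ht => hreal x t hx ht)
    exact (han x y (by simpa using hx) (by simpa using hy)).fun_comp
      (f := fun y : ℂ => ((x : ℂ) + y * I, (x : ℂ) - y * I)) (by fun_prop)
  have hfull : ∀ y : ℂ, ‖y‖ < ρ → ∀ x : ℂ, ‖x‖ < ρ → Φ (x + y * I, x - y * I) = 0 := by
    intro y hy
    refine eqOn_zero_of_forall_real hρ (g := fun x => Φ (x + y * I, x - y * I))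
      (fun x hx => ?_) (fun t ht => hhalf t ht y hy)
    exact (han x y (by simpa using hx) (by simpa using hy)).fun_comp
      (f := fun x : ℂ => (x + y * I, x - y * I)) (by fun_prop)
  refine Metric.eventually_nhds_iff.2 ⟨ρ, hρ, ?_⟩
  rintro ⟨z, w⟩ hzw
  rw [dist_zero_right, Prod.norm_def, max_lt_iff] at hzw
  simp only at hzw
  have h1 := norm_add_le z w
  have h2 := norm_sub_le z w
  have := hfull (-I * (z - w) / 2) (by simp; linarith [hzw.1, hzw.2])
    ((z + w) / 2) (by simp; linarith [hzw.1, hzw.2])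
  convert this using 3 <;> ring_nf <;> simp only [I_sq] <;> ring

namespace analyticAtZero

open PowerSeries

variable {ι : Type*} [Fintype ι]

/-- The kernel `κ + ∑ A_j(z) B_j(w)` as a function of `w`. -/
noncomputable def kernel (κ : ℂ) (A B : ι → analyticAtZero) (z : ℂ) : analyticAtZero :=
  algebraMap ℂ _ κ + ∑ j, evalHom z (A j) • B j

lemma kernel_apply (κ : ℂ) (A B : ι → analyticAtZero) (z w : ℂ) :
    (kernel κ A B z : ℂ → ℂ) w = κ + ∑ j, (A j : ℂ → ℂ) z * (B j : ℂ → ℂ) w := by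
  simp [kernel, evalHom_apply, Pi.algebraMap_apply]

/-- The kernel `κ + ∑ A_j(z) B_j(w)` expanded in powers of `w`. -/
noncomputable def kernelSeries (κ : ℂ) (A B : ι → analyticAtZero) : analyticAtZero⟦X⟧ :=
  C (algebraMap ℂ _ κ) + ∑ j, C (A j) * map (algebraMap ℂ analyticAtZero) (taylor (B j))

lemma coeff_kernelSeries (κ : ℂ) (A B : ι → analyticAtZero) (n : ℕ) :
    coeff n (kernelSeries κ A B) = algebraMap ℂ _ (if n = 0 then κ else 0) +
      ∑ j, coeff n (taylor (B j)) • A j := by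
  simp only [kernelSeries, map_add, map_sum, coeff_C_mul, coeff_map, coeff_C, Algebra.smul_def]
  congr 1
  · split_ifs <;> simp
  · exact Finset.sum_congr rfl fun j _ => mul_comm _ _

lemma map_evalHom_kernelSeries (κ : ℂ) (A B : ι → analyticAtZero) (z : ℂ) :
    map (evalHom z) (kernelSeries κ A B) = taylor (kernel κ A B z) := by
  ext n
  rw [coeff_map, coeff_kernelSeries]
  simp only [kernel, map_add, map_sum, AlgHom.commutes, Algebra.smul_def, map_mul,
    PowerSeries.algebraMap_apply, Algebra.algebraMap_self, RingHom.id_apply, coeff_C, coeff_C_mul]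
  have h : ∀ c : ℂ, evalHom z (algebraMap ℂ analyticAtZero c) = c := fun c => rfl
  simp only [h]
  congr 1
  exact Finset.sum_congr rfl fun j _ => mul_comm _ _

lemma fg_span_coeff_map_kernelSeries {K : Type*} [Field K] [Algebra ℂ K]
    (φ : analyticAtZero →ₐ[ℂ] K) (κ : ℂ) (A B : ι → analyticAtZero) :
    (Submodule.span ℂ (Set.range fun n =>
      coeff n (map (φ : analyticAtZero →+* K) (kernelSeries κ A B)))).FG := by
  have hfin : (Submodule.span ℂ (insert (1 : K) (Set.range fun j => φ (A j)))).FG :=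
    Submodule.fg_span ((Set.finite_range _).insert 1)
  refine hfin.of_le (Submodule.span_le.2 ?_)
  rintro _ ⟨n, rfl⟩
  simp only [coeff_map, coeff_kernelSeries, RingHom.coe_coe, map_add, AlgHom.commutes, map_sum,
    map_smul]
  refine add_mem ?_ (sum_mem fun j _ => ?_)
  · rw [Algebra.algebraMap_eq_smul_one]
    exact Submodule.smul_mem _ _ (Submodule.subset_span (Set.mem_insert _ _))
  · exact Submodule.smul_mem _ _ (Submodule.subset_span (Set.mem_insert_of_mem _ ⟨j, rfl⟩))

lemma coeff_zero_map_kernelSeries {K : Type*} [Field K] [Algebra ℂ K]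
    (φ : analyticAtZero →ₐ[ℂ] K) (κ : ℂ) (A : ι → analyticAtZero) {B : ι → analyticAtZero}
    (hB : ∀ j, (B j : ℂ → ℂ) 0 = 0) :
    coeff 0 (map (φ : analyticAtZero →+* K) (kernelSeries κ A B)) = algebraMap ℂ K κ := by
  rw [coeff_map, coeff_kernelSeries]
  simp [coeff_zero_taylor, hB, -coeff_zero_eq_constantCoeff]

/-- Taylor expansion at the origin with values in a field. -/
noncomputable def taylorFrac : analyticAtZero →ₐ[ℂ] FractionRing ℂ⟦X⟧ :=
  (IsScalarTower.toAlgHom ℂ ℂ⟦X⟧ (FractionRing ℂ⟦X⟧)).comp taylor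

lemma taylorFrac_eq_zero_iff (f : analyticAtZero) :
    taylorFrac f = 0 ↔ (f : ℂ → ℂ) =ᶠ[𝓝 0] 0 := by
  rw [← taylor_eq_zero_iff]
  exact map_eq_zero_iff _ (IsFractionRing.injective ℂ⟦X⟧ (FractionRing ℂ⟦X⟧))

lemma map_taylorFrac_eq_zero {P : analyticAtZero⟦X⟧}
    (h : ∀ᶠ z in 𝓝 (0 : ℂ), map (evalHom z) P = 0) :
    map (taylorFrac : analyticAtZero →+* FractionRing ℂ⟦X⟧) P = 0 := by
  ext n
  rw [coeff_map, map_zero]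
  refine (taylorFrac_eq_zero_iff _).2 ?_
  filter_upwards [h] with z hz
  have := congrArg (coeff n) hz
  rwa [coeff_map, map_zero] at this

lemma eq_const_of_isIntegral_taylorFrac {f : analyticAtZero}
    (h : IsIntegral ℂ (taylorFrac f)) : ∀ᶠ z in 𝓝 (0 : ℂ), (f : ℂ → ℂ) z = (f : ℂ → ℂ) 0 := by
  obtain ⟨x, hx⟩ : ∃ x, algebraMap ℂ (FractionRing ℂ⟦X⟧) x = taylorFrac f := by
    let L := integralClosure ℂ (FractionRing ℂ⟦X⟧)
    obtain ⟨x, hx⟩ := (IsAlgClosed.algebraMap_bijective_of_isIntegral (k := ℂ) (K := L)).2 ⟨_, h⟩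
    exact ⟨x, congrArg Subtype.val hx⟩
  have h0 : taylorFrac (f - algebraMap ℂ _ x) = 0 := by
    rw [map_sub, AlgHom.commutes, hx, sub_self]
  have h1 := (taylorFrac_eq_zero_iff _).1 h0
  have h2 : ∀ᶠ z in 𝓝 (0 : ℂ), (f : ℂ → ℂ) z = x := by
    filter_upwards [h1] with z hz
    simpa [sub_eq_zero, Pi.algebraMap_apply] using hz
  rw [h2.self_of_nhds]
  exact h2

/-- A nonconstant kernel has a transcendental coefficient. -/
lemma exists_not_isIntegral_coeff_kernelSeries {κ : ℂ} {A B : ι → analyticAtZero}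
    (hA : ∀ j, (A j : ℂ → ℂ) 0 = 0)
    (hne : ¬ ∀ᶠ z in 𝓝 (0 : ℂ), (kernel κ A B z : ℂ → ℂ) (starRingEnd ℂ z) = κ) :
    ∃ n, ¬ IsIntegral ℂ (coeff n (map (taylorFrac : analyticAtZero →+* FractionRing ℂ⟦X⟧)
      (kernelSeries κ A B))) := by
  by_contra! hint
  apply hne
  have hev : ∀ᶠ z in 𝓝 (0 : ℂ), (∀ j, AnalyticAt ℂ (A j : ℂ → ℂ) z) ∧
      ∀ j, AnalyticAt ℂ (B j : ℂ → ℂ) z :=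
    (eventually_all.2 fun j => (A j).2.eventually_analyticAt).and
      (eventually_all.2 fun j => (B j).2.eventually_analyticAt)
  obtain ⟨r, hr, hball⟩ := Metric.eventually_nhds_iff_ball.1 hev
  have hpre := (convex_ball (0 : ℂ) r).isPreconnected
  have hcoeff : ∀ n, ∀ z ∈ Metric.ball (0 : ℂ) r,
      evalHom z (coeff n (kernelSeries κ A B)) = if n = 0 then κ else 0 := by
    intro n z hz
    have hexp : ∀ z, evalHom z (coeff n (kernelSeries κ A B)) =
        (if n = 0 then κ else 0) + ∑ j, coeff n (taylor (B j)) * (A j : ℂ → ℂ) z := by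
      intro z
      simp only [coeff_kernelSeries, evalHom_apply]
      simp [Pi.algebraMap_apply]
    have h1 := eq_const_of_isIntegral_taylorFrac (by simpa using hint n)
    have h2 := AnalyticOnNhd.eqOn_of_preconnected_of_eventuallyEq (𝕜 := ℂ)
      (f := fun z => (if n = 0 then κ else 0) + ∑ j, coeff n (taylor (B j)) * (A j : ℂ → ℂ) z)
      (g := fun _ => (if n = 0 then κ else 0)) (z₀ := 0) (U := Metric.ball 0 r) ?_
      (fun _ _ => analyticAt_const) hpre (Metric.mem_ball_self hr) ?_ hz
    · rw [hexp]
      exact h2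
    · intro y hy
      exact analyticAt_const.add (Finset.analyticAt_fun_sum _ fun j _ =>
        analyticAt_const.mul ((hball y hy).1 j))
    · filter_upwards [h1] with y hy
      rw [← evalHom_apply, ← evalHom_apply, hexp, hexp] at hy
      simpa [hA] using hy
  have hrow : ∀ z ∈ Metric.ball (0 : ℂ) r, ∀ w ∈ Metric.ball (0 : ℂ) r,
      (kernel κ A B z : ℂ → ℂ) w = κ := by
    intro z hz w hw
    have h0 : taylor (kernel κ A B z - algebraMap ℂ _ κ) = 0 := by
      rw [map_sub, ← map_evalHom_kernelSeries, AlgHom.commutes]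
      ext n
      rw [map_sub, coeff_map, hcoeff n z hz]
      simp [coeff_C]
    refine AnalyticOnNhd.eqOn_of_preconnected_of_eventuallyEq (𝕜 := ℂ)
      (f := (kernel κ A B z : ℂ → ℂ)) (g := fun _ => κ) (z₀ := 0) (U := Metric.ball 0 r) ?_
      (fun _ _ => analyticAt_const) hpre (Metric.mem_ball_self hr) ?_ hw
    · intro y hy
      have : (kernel κ A B z : ℂ → ℂ) =
          fun w => κ + ∑ j, (A j : ℂ → ℂ) z * (B j : ℂ → ℂ) w := funext (kernel_apply _ _ _ _)
      rw [this]
      exact analyticAt_const.add (Finset.analyticAt_fun_sum _ fun j _ =>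
        analyticAt_const.mul ((hball y hy).2 j))
    · filter_upwards [(taylor_eq_zero_iff _).1 h0] with y hy
      simpa [sub_eq_zero, Pi.algebraMap_apply] using hy
  filter_upwards [Metric.ball_mem_nhds (0 : ℂ) hr] with z hz
  exact hrow z hz _ (by simpa using hz)

variable {ι' ι'' : Type*} [Fintype ι'] [Fintype ι'']

lemma analyticAt_kernel (κ : ℂ) (A B : ι → analyticAtZero) :
    AnalyticAt ℂ (fun x : ℂ × ℂ => (kernel κ A B x.1 : ℂ → ℂ) x.2) 0 := by
  simp only [kernel_apply]
  refine analyticAt_const.add (Finset.analyticAt_fun_sum _ fun j _ => AnalyticAt.mul ?_ ?_)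
  · exact AnalyticAt.fun_comp_of_eq (A j).2 analyticAt_fst rfl
  · exact AnalyticAt.fun_comp_of_eq (B j).2 analyticAt_snd rfl

/-- If a nonconstant polarized kernel has a power which is a quotient of two kernels, then the
exponent is rational. -/
theorem exists_rat_of_kernel_cpow_eq_div {μ a b c : ℂ} {A B : ι → analyticAtZero}
    {A' B' : ι' → analyticAtZero} {A'' B'' : ι'' → analyticAtZero}
    (hA : ∀ j, (A j : ℂ → ℂ) 0 = 0) (hB : ∀ j, (B j : ℂ → ℂ) 0 = 0)
    (hB' : ∀ j, (B' j : ℂ → ℂ) 0 = 0) (hB'' : ∀ j, (B'' j : ℂ → ℂ) 0 = 0)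
    (ha : a ∈ slitPlane) (hb : b ≠ 0) (hc : c ≠ 0)
    (heq : ∀ᶠ z in 𝓝 (0 : ℂ), (kernel a A B z : ℂ → ℂ) (starRingEnd ℂ z) ^ μ =
      (kernel b A' B' z : ℂ → ℂ) (starRingEnd ℂ z) / (kernel c A'' B'' z : ℂ → ℂ) (starRingEnd ℂ z))
    (hne : ¬ ∀ᶠ z in 𝓝 (0 : ℂ), (kernel a A B z : ℂ → ℂ) (starRingEnd ℂ z) = a) :
    ∃ q : ℚ, μ = q := by
  have hFan := analyticAt_kernel a A B
  have hGan := analyticAt_kernel b A' B'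
  have hHan := analyticAt_kernel c A'' B''
  have hF0 : (kernel a A B 0 : ℂ → ℂ) 0 = a := by simp [kernel_apply, hB]
  have hH0 : (kernel c A'' B'' 0 : ℂ → ℂ) 0 = c := by simp [kernel_apply, hB'']
  have hpol : ∀ᶠ x in 𝓝 (0 : ℂ × ℂ), (kernel a A B x.1 : ℂ → ℂ) x.2 ^ μ *
      (kernel c A'' B'' x.1 : ℂ → ℂ) x.2 - (kernel b A' B' x.1 : ℂ → ℂ) x.2 = 0 := by
    apply eventually_eq_zero_of_conj_diagonal
    · exact ((hFan.cpow analyticAt_const (by simpa [hF0] using ha)).mul hHan).sub hGan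
    · have hdiag : Tendsto (fun z : ℂ => (z, starRingEnd ℂ z)) (𝓝 0) (𝓝 0) :=
        (continuous_id.prodMk continuous_conj).tendsto' _ _ (by simp)
      have hHne : ∀ᶠ x in 𝓝 (0 : ℂ × ℂ), (kernel c A'' B'' x.1 : ℂ → ℂ) x.2 ≠ 0 :=
        hHan.continuousAt.eventually_ne (by simpa [hH0] using hc)
      filter_upwards [heq, hdiag.eventually hHne] with z hz hz'
      rw [hz, div_mul_cancel₀ _ hz', sub_self]
  have hslit : ∀ᶠ x in 𝓝 (0 : ℂ × ℂ), (kernel a A B x.1 : ℂ → ℂ) x.2 ∈ slitPlane :=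
    hFan.continuousAt.eventually_mem (isOpen_slitPlane.mem_nhds (by simpa [hF0] using ha))
  have hode : ∀ᶠ z in 𝓝 (0 : ℂ), ∀ᶠ w in 𝓝 (0 : ℂ),
      μ * deriv (kernel a A B z : ℂ → ℂ) w * (kernel b A' B' z : ℂ → ℂ) w *
        (kernel c A'' B'' z : ℂ → ℂ) w = (kernel a A B z : ℂ → ℂ) w *
        (deriv (kernel b A' B' z : ℂ → ℂ) w * (kernel c A'' B'' z : ℂ → ℂ) w -
          (kernel b A' B' z : ℂ → ℂ) w * deriv (kernel c A'' B'' z : ℂ → ℂ) w) := by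
    have hloc := (hpol.eventually_nhds.and hslit).curry_nhds
    filter_upwards [hloc] with z hz
    filter_upwards [hz, (kernel a A B z).2.eventually_analyticAt,
      (kernel b A' B' z).2.eventually_analyticAt, (kernel c A'' B'' z).2.eventually_analyticAt]
      with w ⟨hw, hws⟩ hFw hGw hHw
    have hw' : ∀ᶠ y in 𝓝 w, (kernel a A B z : ℂ → ℂ) y ^ μ *
        (kernel c A'' B'' z : ℂ → ℂ) y = (kernel b A' B' z : ℂ → ℂ) y := by
      have ht : Tendsto (fun y : ℂ => (z, y)) (𝓝 w) (𝓝 (z, w)) :=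
        (Continuous.prodMk_right z).tendsto w
      filter_upwards [ht.eventually hw] with y hy using sub_eq_zero.1 hy
    have hF' := hFw.differentiableAt.hasDerivAt
    have hd := ((hF'.cpow_const (c := μ) hws).mul hHw.differentiableAt.hasDerivAt).unique
      (hGw.differentiableAt.hasDerivAt.congr_of_eventuallyEq hw')
    have hFne : (kernel a A B z : ℂ → ℂ) w ≠ 0 := slitPlane_ne_zero hws
    have hpow : (kernel a A B z : ℂ → ℂ) w ^ (μ - 1) * (kernel a A B z : ℂ → ℂ) w =
        (kernel a A B z : ℂ → ℂ) w ^ μ := by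
      rw [cpow_sub _ _ hFne, cpow_one, div_mul_cancel₀ _ hFne]
    rw [← hd, ← hw'.self_of_nhds, ← hpow]
    ring
  let φ : analyticAtZero →+* FractionRing ℂ⟦X⟧ := (taylorFrac : _ →+* FractionRing ℂ⟦X⟧)
  set F := kernelSeries a A B with hF
  set G := kernelSeries b A' B' with hG
  set H := kernelSeries c A'' B'' with hH
  have hφ : ∀ x : ℂ, φ (algebraMap ℂ _ x) = algebraMap ℂ (FractionRing ℂ⟦X⟧) x :=
    fun x => taylorFrac.commutes x
  have key : PowerSeries.map φ (C (algebraMap ℂ analyticAtZero μ) *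
      PowerSeries.derivative _ F * G * H -
      F * (PowerSeries.derivative _ G * H - G * PowerSeries.derivative _ H)) = 0 := by
    apply map_taylorFrac_eq_zero
    filter_upwards [hode] with z hz
    simp only [map_sub, map_mul, ← derivative_map, hF, hG, hH, map_evalHom_kernelSeries, map_C,
      ← taylor_derivative]
    have hμ : C (evalHom z (algebraMap ℂ analyticAtZero μ)) = taylor (algebraMap ℂ _ μ) := by
      rw [AlgHom.commutes]
      rfl
    rw [hμ]
    simp only [← map_mul, ← map_sub]
    rw [taylor_eq_zero_iff]
    filter_upwards [hz] with w hw
    have : (algebraMap ℂ analyticAtZero μ : ℂ → ℂ) w = μ := rfl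
    simp only [AddSubgroupClass.coe_sub, MulMemClass.coe_mul, Pi.sub_apply, Pi.mul_apply, this,
      Pi.zero_apply]
    exact sub_eq_zero.2 hw
  have hne0 : ∀ {x : ℂ} {P : (FractionRing ℂ⟦X⟧)⟦X⟧}, x ≠ 0 →
      coeff 0 P = algebraMap ℂ (FractionRing ℂ⟦X⟧) x → P ≠ 0 := by
    rintro x P hx hP rfl
    exact hx ((map_eq_zero (algebraMap ℂ (FractionRing ℂ⟦X⟧))).1 (by simpa using hP.symm))
  refine exists_rat_of_logDeriv_eq_of_transcendental (k := ℂ) (K := FractionRing ℂ⟦X⟧)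
    (a := a) (F := PowerSeries.map φ F) (G := PowerSeries.map φ G) (H := PowerSeries.map φ H)
    (hne0 (slitPlane_ne_zero ha) (coeff_zero_map_kernelSeries taylorFrac a A hB))
    (hne0 hb (coeff_zero_map_kernelSeries taylorFrac b A' hB'))
    (hne0 hc (coeff_zero_map_kernelSeries taylorFrac c A'' hB''))
    (fg_span_coeff_map_kernelSeries taylorFrac a A B)
    (fg_span_coeff_map_kernelSeries taylorFrac b A' B')
    (fg_span_coeff_map_kernelSeries taylorFrac c A'' B'')
    (coeff_zero_map_kernelSeries taylorFrac a A hB)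
    (exists_not_isIntegral_coeff_kernelSeries hA hne) ?_
  simpa only [map_sub, map_mul, map_C, hφ, ← derivative_map, sub_eq_zero] using key

end analyticAtZero

/-- A real analytic function that is constant near `p` along every line through `p` is constant
near `p`. -/
lemma AnalyticAt.eventually_eq_const_of_forall_line {E : Type*} [NormedAddCommGroup E]
    [NormedSpace ℝ E] {g : E → ℝ} {p : E} (hg : AnalyticAt ℝ g p)
    (h : ∀ v : E, ∀ᶠ t : ℝ in 𝓝 0, g (p + t • v) = g p) : ∀ᶠ z in 𝓝 p, g z = g p := by
  obtain ⟨r, hr, hball⟩ := Metric.eventually_nhds_iff_ball.1 hg.eventually_analyticAt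
  filter_upwards [Metric.ball_mem_nhds p hr] with z hz
  have hseg : ∀ t ∈ Set.Icc (0 : ℝ) 1, p + t • (z - p) ∈ Metric.ball p r := fun t ht =>
    (convex_ball p r).add_smul_sub_mem (Metric.mem_ball_self hr) hz ht
  have := AnalyticOnNhd.eqOn_of_preconnected_of_eventuallyEq (𝕜 := ℝ)
    (f := fun t : ℝ => g (p + t • (z - p))) (g := fun _ => g p) (z₀ := 0) (U := Set.Icc 0 1)
    (fun t ht => (hball _ (hseg t ht)).fun_comp (f := fun t : ℝ => p + t • (z - p))
      (analyticAt_const.add (analyticAt_id.smul analyticAt_const)))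
    (fun _ _ => analyticAt_const) isPreconnected_Icc (by simp) (h (z - p))
    (show (1 : ℝ) ∈ Set.Icc 0 1 by simp)
  simpa using this

section hermR

variable {n m : ℕ} {p : Fin n → ℂ} {α : Fin m → (Fin n → ℂ) → ℂ}

lemma hermR_eq_zero (ℓ : ℕ) (h0 : ∀ j, α j p = 0) : hermR ℓ α p = 0 := by
  simp [hermR, h0]

lemma analyticAt_hermR (ℓ : ℕ) (hα : ∀ j, AnalyticAt ℂ (α j) p) :
    AnalyticAt ℝ (hermR ℓ α) p := by
  unfold hermR
  refine Finset.analyticAt_fun_sum _ fun j _ => analyticAt_const.mul ?_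
  simp only [normSq_apply]
  have h := (hα j).restrictScalars (𝕜 := ℝ)
  have hre : AnalyticAt ℝ (fun z => (α j z).re) p := (reCLM.analyticAt _).fun_comp h
  have him : AnalyticAt ℝ (fun z => (α j z).im) p := (imCLM.analyticAt _).fun_comp h
  exact (hre.mul hre).add (him.mul him)

/-- On a complex line, `κ + hermR ℓ α` is the restriction of a kernel to the conjugate diagonal. -/
lemma exists_kernel_eq_hermR (ℓ : ℕ) (hα : ∀ j, AnalyticAt ℂ (α j) p) (h0 : ∀ j, α j p = 0)
    (v : Fin n → ℂ) :
    ∃ A B : Fin m → analyticAtZero, (∀ j, (A j : ℂ → ℂ) 0 = 0) ∧ (∀ j, (B j : ℂ → ℂ) 0 = 0) ∧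
      ∀ (κ : ℝ) (z : ℂ), (analyticAtZero.kernel κ A B z : ℂ → ℂ) (starRingEnd ℂ z) =
        ((κ + hermR ℓ α (p + z • v) : ℝ) : ℂ) := by
  have hline : ∀ j, AnalyticAt ℂ (fun t : ℂ => α j (p + t • v)) 0 := fun j =>
    AnalyticAt.fun_comp_of_eq (hα j)
      (analyticAt_const.add (analyticAt_id.smul analyticAt_const)) (by simp)
  have hconj : ∀ j, AnalyticAt ℂ
      (fun t : ℂ => starRingEnd ℂ (α j (p + starRingEnd ℂ t • v))) 0 := by
    intro j
    rw [analyticAt_iff_eventually_differentiableAt]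
    have ht : Tendsto (starRingEnd ℂ) (𝓝 0) (𝓝 0) := continuous_conj.tendsto' _ _ (by simp)
    filter_upwards [ht.eventually (hline j).eventually_analyticAt] with t h
    have := h.differentiableAt.conj_conj
    rwa [conj_conj] at this
  refine ⟨fun j => ⟨fun t => (if (j : ℕ) < ℓ then 1 else -1) * α j (p + t • v),
    analyticAt_const.mul (hline j)⟩, fun j => ⟨_, hconj j⟩, fun j => by simp [h0],
    fun j => by simp [h0], fun κ z => ?_⟩
  simp only [analyticAtZero.kernel_apply, hermR, conj_conj, ofReal_add, ofReal_sum, ofReal_mul,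
    normSq_eq_conj_mul_self, mul_assoc]
  congr 1
  refine Finset.sum_congr rfl fun j _ => ?_
  rw [mul_comm (starRingEnd ℂ _)]
  split_ifs <;> simp

end hermR

/-- If `f = a + ⟨α,α⟩_ℓ ∈ Λ̃_p` is positive near `p` and `f^μ` lies in the fraction
field `K̃_p` without being constant near `p`, then `μ` is rational. -/
theorem stmt10 {n : ℕ} (p : Fin n → ℂ) (μ : ℝ)
    {mα mβ mγ : ℕ} (ℓ q r : ℕ) (hℓ : ℓ ≤ mα) (hq : q ≤ mβ) (hr : r ≤ mγ)
    (α : Fin mα → (Fin n → ℂ) → ℂ) (β : Fin mβ → (Fin n → ℂ) → ℂ)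
    (γ : Fin mγ → (Fin n → ℂ) → ℂ)
    (hαa : ∀ j, AnalyticAt ℂ (α j) p) (hα0 : ∀ j, α j p = 0)
    (hβa : ∀ j, AnalyticAt ℂ (β j) p) (hβ0 : ∀ j, β j p = 0)
    (hγa : ∀ j, AnalyticAt ℂ (γ j) p) (hγ0 : ∀ j, γ j p = 0)
    (a b c : ℝ)
    (hfpos : ∀ᶠ z in 𝓝 p, 0 < a + hermR ℓ α z)
    (hcne : c + hermR r γ p ≠ 0)
    (heq : ∀ᶠ z in 𝓝 p,
      (a + hermR ℓ α z) ^ μ = (b + hermR q β z) / (c + hermR r γ z))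
    (hnc : ¬ ∃ C : ℝ, ∀ᶠ z in 𝓝 p, (a + hermR ℓ α z) ^ μ = C) :
    ∃ q' : ℚ, μ = (q' : ℝ) := by
  have hfp : hermR ℓ α p = 0 := hermR_eq_zero ℓ hα0
  have ha : 0 < a := by simpa [hfp] using hfpos.self_of_nhds
  have hc : c ≠ 0 := by simpa [hermR_eq_zero r hγ0] using hcne
  have hb : b ≠ 0 := by
    rintro rfl
    have := heq.self_of_nhds
    simp only [hfp, hermR_eq_zero q hβ0, add_zero, zero_div] at this
    exact (Real.rpow_pos_of_pos ha μ).ne' this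
  obtain ⟨v, hv⟩ : ∃ v, ¬ ∀ᶠ t : ℂ in 𝓝 0, a + hermR ℓ α (p + t • v) = a := by
    by_contra! hcon
    refine hnc ⟨a ^ μ, ?_⟩
    have hline := AnalyticAt.eventually_eq_const_of_forall_line (analyticAt_hermR ℓ hαa)
      fun v => by
        have ht : Tendsto ((↑) : ℝ → ℂ) (𝓝 0) (𝓝 0) := continuous_ofReal.tendsto' _ _ (by simp)
        filter_upwards [ht.eventually (hcon v)] with t h
        simpa [hfp] using h
    filter_upwards [hline] with z hz
    rw [hz, hfp, add_zero]
  obtain ⟨A, B, hA, hB, hAB⟩ := exists_kernel_eq_hermR ℓ hαa hα0 v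
  obtain ⟨A', B', -, hB', hAB'⟩ := exists_kernel_eq_hermR q hβa hβ0 v
  obtain ⟨A'', B'', -, hB'', hAB''⟩ := exists_kernel_eq_hermR r hγa hγ0 v
  have hline : Tendsto (fun t : ℂ => p + t • v) (𝓝 0) (𝓝 p) :=
    Continuous.tendsto' (by fun_prop) _ _ (by simp)
  obtain ⟨s, hs⟩ := analyticAtZero.exists_rat_of_kernel_cpow_eq_div (μ := (μ : ℂ)) (a := (a : ℂ))
    (b := (b : ℂ)) (c := (c : ℂ)) hA hB hB' hB'' (ofReal_mem_slitPlane.2 ha) (mod_cast hb)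
    (mod_cast hc) (by
      filter_upwards [hline.eventually hfpos, hline.eventually heq] with t hpos ht
      rw [hAB, hAB', hAB'', ← ofReal_cpow hpos.le, ht, ofReal_div])
    (by simpa only [hAB, ofReal_inj] using hv)
  exact ⟨s, mod_cast hs⟩
end
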